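/- arXiv:1602.06901 — 2 statements merged into one kernel-verified Lean document; each statement's English description precedes it below -/
import Mathlib

section
/- Let F be a field of characteristic 2 with 2 ≤ u(F) < ∞. Then every central simple F-algebra of exponent 2 is Brauer equivalent to a tensor product of at most u(F)/2 − 1 quaternion algebras. -/
open scoped TensorProduct

/-- The defining relations of the symbol `p`-algebra
`[a,b)_{p,F} = F⟨x,y : x^p - x = a, y^p = b, yx - xy = y⟩`. -/
inductive SymbolRel (F : Type) [Field F] (p : ℕ) (a b : F) :
    FreeAlgebra F (Fin 2) → FreeAlgebra F (Fin 2) → Prop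
  | x : SymbolRel F p a b (FreeAlgebra.ι F 0 ^ p - FreeAlgebra.ι F 0) (algebraMap F _ a)
  | y : SymbolRel F p a b (FreeAlgebra.ι F 1 ^ p) (algebraMap F _ b)
  | comm : SymbolRel F p a b
      (FreeAlgebra.ι F 1 * FreeAlgebra.ι F 0 - FreeAlgebra.ι F 0 * FreeAlgebra.ι F 1)
      (FreeAlgebra.ι F 1)

/-- The symbol `p`-algebra `[a,b)_{p,F}`. -/
abbrev SymbolAlg (F : Type) [Field F] (p : ℕ) (a b : F) : Type :=
  RingQuot (SymbolRel F p a b)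

/-- The nonsingular quadratic form `[a₁,b₁] ⊥ ⋯ ⊥ [aₙ,bₙ]` over a field of
characteristic 2, where `[a,b](u,v) = a·u² + u·v + b·v²`. -/
def binSum (F : Type) [Field F] {n : ℕ} (a b : Fin n → F) : (Fin n → F × F) → F :=
  fun v => ∑ i, (a i * (v i).1 ^ 2 + (v i).1 * (v i).2 + b i * (v i).2 ^ 2)

/-- The form `[a₁,b₁] ⊥ ⋯ ⊥ [aₙ,bₙ]` is anisotropic: it has no nontrivial zero. -/
def AnisoBin (F : Type) [Field F] {n : ℕ} (a b : Fin n → F) : Prop :=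
  ∀ v : Fin n → F × F, binSum F a b v = 0 → v = 0

/-- Two `F`-algebras are Brauer equivalent if they become isomorphic after tensoring
with matrix algebras, i.e. `M_n(A) ≅ M_m(B)` for some positive `n`, `m`. -/
def BrauerEquiv (F A B : Type) [Field F] [Ring A] [Ring B] [Algebra F A] [Algebra F B] :
    Prop :=
  ∃ (n m : ℕ), 0 < n ∧ 0 < m ∧
    Nonempty (Matrix (Fin n) (Fin n) A ≃ₐ[F] Matrix (Fin m) (Fin m) B)

section SimpleTensor

variable {F A B : Type*} [Field F] [Ring A] [Ring B] [Algebra F A] [Algebra F B]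

theorem tensorBasis_repr_mul_tmul_one {ι : Type*} (bs : Module.Basis ι F B) (x : A ⊗[F] B) (a : A)
    (j : ι) : (Algebra.TensorProduct.basis A bs).repr (x * (a ⊗ₜ[F] (1 : B))) j =
      (Algebra.TensorProduct.basis A bs).repr x j * a := by
  induction x with
  | zero => simp
  | tmul c b => simp [mul_assoc, Algebra.commutes]
  | add x y hx hy => simp [add_mul, hx, hy]

theorem tensorBasis_repr_tmul_one_mul {ι : Type*} (bs : Module.Basis ι F B) (x : A ⊗[F] B) (a : A)
    (j : ι) : (Algebra.TensorProduct.basis A bs).repr ((a ⊗ₜ[F] (1 : B)) * x) j =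
      a * (Algebra.TensorProduct.basis A bs).repr x j := by
  induction x with
  | zero => simp
  | tmul c b => simp [mul_assoc]
  | add x y hx hy => simp [mul_add, hx, hy]

theorem exists_eq_one_tmul_of_forall_commute [Algebra.IsCentral F A] (z : A ⊗[F] B)
    (hz : ∀ a : A, (a ⊗ₜ[F] (1 : B)) * z = z * (a ⊗ₜ[F] (1 : B))) :
    ∃ b : B, z = (1 : A) ⊗ₜ[F] b := by
  let bs := Module.Basis.ofVectorSpace F B
  let Bs := Algebra.TensorProduct.basis A bs
  have hmulr := tensorBasis_repr_mul_tmul_one (A := A) bs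
  have hmull := tensorBasis_repr_tmul_one_mul (A := A) bs
  have hc : ∀ j, ∃ c : F, Bs.repr z j = algebraMap F A c := fun j ↦ by
    rw [← Algebra.IsCentral.mem_center_iff, Subalgebra.mem_center_iff]
    intro a
    rw [← hmull, ← hmulr, hz]
  choose c hc using hc
  refine ⟨∑ j ∈ (Bs.repr z).support, c j • bs j, ?_⟩
  conv_lhs => rw [← Bs.linearCombination_repr z, Finsupp.linearCombination_apply, Finsupp.sum]
  rw [TensorProduct.tmul_sum]
  refine Finset.sum_congr rfl fun j _ ↦ ?_
  rw [hc, Algebra.TensorProduct.basis_apply, TensorProduct.smul_tmul', TensorProduct.tmul_smul,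
    TensorProduct.smul_tmul', smul_eq_mul, mul_one, Algebra.algebraMap_eq_smul_one]

theorem isSimpleRing_tensorProduct [Algebra.IsCentral F A] [IsSimpleRing A] [IsSimpleRing B] :
    IsSimpleRing (A ⊗[F] B) := by
  classical
  let bs := Module.Basis.ofVectorSpace F B
  let Bs := Algebra.TensorProduct.basis A bs
  have hmulr := tensorBasis_repr_mul_tmul_one (A := A) bs
  have hmull := tensorBasis_repr_tmul_one_mul (A := A) bs
  refine IsSimpleRing.of_eq_bot_or_eq_top fun I ↦ or_iff_not_imp_left.2 fun hI ↦ ?_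
  obtain ⟨x₀, hx₀I, hx₀⟩ := SetLike.exists_of_lt (bot_lt_iff_ne_bot.mpr hI)
  have hne : ∃ n, ∃ x ∈ I, x ≠ 0 ∧ (Bs.repr x).support.card = n := ⟨_, x₀, hx₀I, hx₀, rfl⟩
  obtain ⟨x, hxI, hx, hcard⟩ := Nat.find_spec hne
  obtain ⟨j, hj⟩ : (Bs.repr x).support.Nonempty := by
    rw [Finsupp.support_nonempty_iff]
    simpa using hx
  let J : TwoSidedIdeal A := TwoSidedIdeal.mk'
    {a | ∃ y ∈ I, (Bs.repr y).support ⊆ (Bs.repr x).support ∧ Bs.repr y j = a}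
    ⟨0, I.zero_mem, by simp, by simp⟩
    (by
      rintro a b ⟨y, hy, hys, rfl⟩ ⟨z, hz, hzs, rfl⟩
      refine ⟨y + z, I.add_mem hy hz, ?_, by simp⟩
      rw [map_add]
      exact Finsupp.support_add.trans (Finset.union_subset hys hzs))
    (by
      rintro a ⟨y, hy, hys, rfl⟩
      exact ⟨-y, I.neg_mem hy, by rwa [map_neg, Finsupp.support_neg], by simp⟩)
    (by
      rintro a b ⟨y, hy, hys, rfl⟩
      refine ⟨(a ⊗ₜ[F] (1 : B)) * y, I.mul_mem_left _ _ hy, fun k hk ↦ hys ?_, hmull _ _ _⟩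
      rw [Finsupp.mem_support_iff, hmull] at hk
      exact Finsupp.mem_support_iff.2 (right_ne_zero_of_mul hk))
    (by
      rintro a b ⟨y, hy, hys, rfl⟩
      refine ⟨y * (b ⊗ₜ[F] (1 : B)), I.mul_mem_right _ _ hy, fun k hk ↦ hys ?_, hmulr _ _ _⟩
      rw [Finsupp.mem_support_iff, hmulr] at hk
      exact Finsupp.mem_support_iff.2 (left_ne_zero_of_mul hk))
  have h1J : (1 : A) ∈ J := by
    refine IsSimpleRing.one_mem_of_ne_zero_mem J (x := Bs.repr x j) (Finsupp.mem_support_iff.1 hj) ?_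
    rw [TwoSidedIdeal.mem_mk']
    exact ⟨x, hxI, le_rfl, rfl⟩
  rw [TwoSidedIdeal.mem_mk'] at h1J
  obtain ⟨y, hyI, hys, hy1⟩ := h1J
  obtain ⟨b, rfl⟩ := exists_eq_one_tmul_of_forall_commute y fun a ↦ by
    by_contra hne'
    rw [← sub_eq_zero.not] at hne'
    refine Nat.find_min hne (m := (Bs.repr ((a ⊗ₜ[F] (1 : B)) * y - y * (a ⊗ₜ[F] 1))).support.card)
      ?_ ⟨_, I.sub_mem (I.mul_mem_left _ _ hyI) (I.mul_mem_right _ _ hyI), hne', rfl⟩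
    rw [← hcard]
    refine Finset.card_lt_card ⟨fun k hk ↦ hys ?_, fun hsub ↦ ?_⟩
    · rw [Finsupp.mem_support_iff, map_sub, Finsupp.sub_apply, hmull, hmulr] at hk
      refine Finsupp.mem_support_iff.2 fun h0 ↦ hk (by rw [h0]; simp)
    · have := hsub hj
      rw [Finsupp.mem_support_iff, map_sub, Finsupp.sub_apply, hmull, hmulr, hy1] at this
      simp at this
  have hb : b ≠ 0 := by
    rintro rfl
    simp at hy1
  let K : TwoSidedIdeal B := TwoSidedIdeal.mk' {c | (1 : A) ⊗ₜ[F] c ∈ I}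
    (by simp)
    (fun {c d} hc hd ↦ by
      simpa [TensorProduct.tmul_add] using I.add_mem hc hd)
    (fun {c} hc ↦ by simpa [TensorProduct.tmul_neg] using I.neg_mem hc)
    (fun {c d} hd ↦ by simpa using I.mul_mem_left ((1 : A) ⊗ₜ[F] c) _ hd)
    (fun {c d} hc ↦ by simpa using I.mul_mem_right _ ((1 : A) ⊗ₜ[F] d) hc)
  have : (1 : B) ∈ K := by
    refine IsSimpleRing.one_mem_of_ne_zero_mem K (x := b) hb ?_
    rw [TwoSidedIdeal.mem_mk']
    exact hyI
  rw [TwoSidedIdeal.mem_mk'] at this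
  exact (TwoSidedIdeal.one_mem_iff I).1 this

theorem isCentral_tensorProduct [Algebra.IsCentral F A] [Algebra.IsCentral F B] [Nontrivial A] :
    Algebra.IsCentral F (A ⊗[F] B) where
  out z hz := by
    rw [Subalgebra.mem_center_iff] at hz
    obtain ⟨b, rfl⟩ := exists_eq_one_tmul_of_forall_commute z fun a ↦ hz _
    have hb : b ∈ Subalgebra.center F B := by
      rw [Subalgebra.mem_center_iff]
      intro c
      have := hz ((1 : A) ⊗ₜ[F] c)
      rw [Algebra.TensorProduct.tmul_mul_tmul, Algebra.TensorProduct.tmul_mul_tmul, one_mul] at this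
      exact Algebra.TensorProduct.includeRight_injective
        (FaithfulSMul.algebraMap_injective F A) this
    obtain ⟨c, rfl⟩ := (Algebra.IsCentral.mem_center_iff F).1 hb
    exact Algebra.mem_bot.2 ⟨c, by
      rw [Algebra.algebraMap_eq_smul_one, Algebra.TensorProduct.one_def,
        Algebra.algebraMap_eq_smul_one, TensorProduct.tmul_smul]⟩

theorem isCentral_baseChange (K : Type*) [Field K] [Algebra F K] [Algebra.IsCentral F A] :
    Algebra.IsCentral K (K ⊗[F] A) where
  out z hz := by
    rw [Subalgebra.mem_center_iff] at hz
    obtain ⟨b, hb⟩ := exists_eq_one_tmul_of_forall_commute (Algebra.TensorProduct.comm F K A z)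
      fun a ↦ by
        have := congrArg (Algebra.TensorProduct.comm F K A) (hz (1 ⊗ₜ a))
        simpa using this
    rw [← AlgEquiv.eq_symm_apply] at hb
    exact ⟨b, by rw [hb]; simp⟩

theorem isSimpleRing_baseChange (K : Type*) [Field K] [Algebra F K] [Algebra.IsCentral F A]
    [IsSimpleRing A] : IsSimpleRing (K ⊗[F] A) :=
  have : IsSimpleRing (A ⊗[F] K) := isSimpleRing_tensorProduct
  IsSimpleRing.of_ringEquiv (Algebra.TensorProduct.comm F A K).toRingEquiv this

/-- A homomorphism from a simple algebra to an algebra of the same dimension is bijective. -/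
theorem AlgHom.bijective_of_finrank_eq [IsSimpleRing A] [Nontrivial B] [FiniteDimensional F A]
    [FiniteDimensional F B] (f : A →ₐ[F] B) (h : Module.finrank F A = Module.finrank F B) :
    Function.Bijective f :=
  have hf : Function.Injective f := RingHom.injective f.toRingHom
  ⟨hf, (LinearMap.injective_iff_surjective_of_finrank_eq_finrank (f := f.toLinearMap) h).1 hf⟩

end SimpleTensor

section BrauerMonoid

variable {F : Type} [Field F]

instance CSA.instFiniteDimensionalTensor (A B : CSA.{0, 0} F) :
    FiniteDimensional F (A ⊗[F] B) := inferInstance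

/-- The tensor product of two central simple algebras. -/
def CSA.tensor (A B : CSA.{0, 0} F) : CSA.{0, 0} F where
  __ := AlgCat.of F (A ⊗[F] B)
  isCentral := isCentral_tensorProduct (A := A) (B := B)
  isSimple := isSimpleRing_tensorProduct (A := A) (B := B)
  fin_dim := inferInstanceAs (FiniteDimensional F (A ⊗[F] B))

/-- The base field as a central simple algebra over itself. -/
def CSA.self (F : Type) [Field F] : CSA.{0, 0} F where
  __ := AlgCat.of F F
  isCentral := inferInstanceAs (Algebra.IsCentral F F)
  isSimple := inferInstanceAs (IsSimpleRing F)
  fin_dim := inferInstanceAs (FiniteDimensional F F)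

/-- The class of a central simple algebra in the Brauer group. -/
def brauerClass (F A : Type) [Field F] [Ring A] [Algebra F A] [FiniteDimensional F A]
    [IsSimpleRing A] [Algebra.IsCentral F A] : BrauerGroup.{0, 0} F :=
  Quotient.mk (Brauer.CSA_Setoid F) { AlgCat.of F A with }

section ClassEq

variable {A B : Type} [Ring A] [Ring B] [Algebra F A] [Algebra F B]
  [FiniteDimensional F A] [FiniteDimensional F B] [IsSimpleRing A] [IsSimpleRing B]
  [Algebra.IsCentral F A] [Algebra.IsCentral F B]

theorem brauerClass_eq_iff : brauerClass F A = brauerClass F B ↔ BrauerEquiv F A B := by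
  refine Quotient.eq (r := Brauer.CSA_Setoid F) |>.trans ⟨?_, ?_⟩
  · rintro ⟨n, m, hn, hm, h⟩
    exact ⟨n, m, hn.bot_lt, hm.bot_lt, h⟩
  · rintro ⟨n, m, hn, hm, h⟩
    exact ⟨n, m, hn.ne', hm.ne', h⟩

theorem brauerClass_eq_of_algEquiv (e : A ≃ₐ[F] B) : brauerClass F A = brauerClass F B :=
  brauerClass_eq_iff.2 ⟨1, 1, one_pos, one_pos, ⟨e.mapMatrix⟩⟩

theorem brauerClass_eq_of_algHom (f : A →ₐ[F] B)
    (h : Module.finrank F A = Module.finrank F B) : brauerClass F A = brauerClass F B :=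
  brauerClass_eq_of_algEquiv (AlgEquiv.ofBijective f (f.bijective_of_finrank_eq h))

theorem brauerClass_eq_matrix (n : ℕ) [NeZero n] :
    brauerClass F A = brauerClass F (Matrix (Fin n) (Fin n) A) :=
  brauerClass_eq_iff.2 ⟨n, 1, NeZero.pos n, one_pos,
    ⟨((Matrix.compAlgEquiv (Fin 1) (Fin n) A F).trans
      (Matrix.reindexAlgEquiv F A (Equiv.uniqueProd (Fin n) (Fin 1)))).symm⟩⟩

end ClassEq

theorem IsBrauerEquivalent.tensor {A A' B B' : CSA.{0, 0} F} (hA : IsBrauerEquivalent A A')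
    (hB : IsBrauerEquivalent B B') : IsBrauerEquivalent (A.tensor B) (A'.tensor B') := by
  obtain ⟨n, n', hn, hn', ⟨e⟩⟩ := hA
  obtain ⟨m, m', hm, hm', ⟨e'⟩⟩ := hB
  let g (n m : ℕ) (A B : CSA.{0, 0} F) :
      (Matrix (Fin n) (Fin n) A ⊗[F] Matrix (Fin m) (Fin m) B) ≃ₐ[F]
        Matrix (Fin (n * m)) (Fin (n * m)) (A ⊗[F] B) :=
    (Matrix.kroneckerTMulAlgEquiv (Fin n) (Fin m) F F A B).trans
      (Matrix.reindexAlgEquiv F (A ⊗[F] B) finProdFinEquiv)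
  exact ⟨n * m, n' * m', mul_ne_zero hn hm, mul_ne_zero hn' hm',
    ⟨((g n m A B).symm.trans (Algebra.TensorProduct.congr e e')).trans (g n' m' A' B')⟩⟩

/-- The Brauer monoid: the product is induced by the tensor product. -/
noncomputable instance : CommMonoid (BrauerGroup.{0, 0} F) where
  mul := Quotient.map₂ CSA.tensor fun _ _ h _ _ h' ↦ h.tensor h'
  one := Quotient.mk _ (CSA.self F)
  mul_assoc := by
    rintro ⟨A⟩ ⟨B⟩ ⟨C⟩
    exact Quotient.sound ⟨1, 1, one_ne_zero, one_ne_zero,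
      ⟨(Algebra.TensorProduct.assoc F F F A B C).mapMatrix⟩⟩
  one_mul := by
    rintro ⟨A⟩
    exact Quotient.sound ⟨1, 1, one_ne_zero, one_ne_zero,
      ⟨(Algebra.TensorProduct.lid F A).mapMatrix⟩⟩
  mul_one := by
    rintro ⟨A⟩
    exact Quotient.sound ⟨1, 1, one_ne_zero, one_ne_zero,
      ⟨(Algebra.TensorProduct.rid F F A).mapMatrix⟩⟩
  mul_comm := by
    rintro ⟨A⟩ ⟨B⟩
    exact Quotient.sound ⟨1, 1, one_ne_zero, one_ne_zero,
      ⟨(Algebra.TensorProduct.comm F A B).mapMatrix⟩⟩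

theorem brauerClass_self : brauerClass F F = 1 := rfl

attribute [local instance] isCentral_tensorProduct isSimpleRing_tensorProduct

variable {A B C D : Type} [Ring A] [Ring B] [Algebra F A] [Algebra F B]
  [FiniteDimensional F A] [FiniteDimensional F B] [IsSimpleRing A] [IsSimpleRing B]
  [Algebra.IsCentral F A] [Algebra.IsCentral F B]
  [Ring C] [Ring D] [Algebra F C] [Algebra F D]
  [FiniteDimensional F C] [FiniteDimensional F D] [IsSimpleRing C] [IsSimpleRing D]
  [Algebra.IsCentral F C] [Algebra.IsCentral F D]

theorem brauerClass_tensor :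
    brauerClass F (A ⊗[F] B) = brauerClass F A * brauerClass F B := rfl

theorem brauerClass_matrix_self (n : ℕ) [NeZero n] :
    brauerClass F (Matrix (Fin n) (Fin n) F) = 1 := by
  rw [← brauerClass_eq_matrix, brauerClass_self]

theorem brauerClass_eq_one_of_algHom {n : ℕ} (f : A →ₐ[F] Matrix (Fin n) (Fin n) F)
    (h : Module.finrank F A = n * n) : brauerClass F A = 1 := by
  have : NeZero n := ⟨by
    rintro rfl
    exact (Module.finrank_pos (R := F) (M := A)).ne' (by simpa using h)⟩
  rw [brauerClass_eq_of_algHom f (by simp [h, Module.finrank_matrix]), brauerClass_matrix_self]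

theorem brauerClass_mul_eq_mul {f : A →ₐ[F] C ⊗[F] D} {g : B →ₐ[F] C ⊗[F] D}
    (h : ∀ a b, Commute (f a) (g b)) (hd : Module.finrank F A * Module.finrank F B =
      Module.finrank F C * Module.finrank F D) :
    brauerClass F A * brauerClass F B = brauerClass F C * brauerClass F D := by
  rw [← brauerClass_tensor, ← brauerClass_tensor]
  exact brauerClass_eq_of_algHom (Algebra.TensorProduct.lift f g h)
    (by rw [Module.finrank_tensorProduct, Module.finrank_tensorProduct, hd])

end BrauerMonoid

theorem neg_eq_self_of_charTwo (F : Type*) {M : Type*} [Ring F] [CharP F 2] [AddCommGroup M]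
    [Module F M] (x : M) : -x = x := by
  rw [neg_eq_iff_add_eq_zero, ← two_smul F, CharTwo.two_eq_zero, zero_smul]

theorem add_self_of_charTwo (F : Type*) {M : Type*} [Ring F] [CharP F 2] [AddCommGroup M]
    [Module F M] (x : M) : x + x = 0 := by
  rw [← two_smul F, CharTwo.two_eq_zero, zero_smul]

section Symbol

namespace SymbolAlg

variable {F : Type} [Field F] {a b : F}

/-- The first generator of a symbol algebra. -/
def X (a b : F) : SymbolAlg F 2 a b := RingQuot.mkAlgHom F _ (FreeAlgebra.ι F 0)

/-- The second generator of a symbol algebra. -/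
def Y (a b : F) : SymbolAlg F 2 a b := RingQuot.mkAlgHom F _ (FreeAlgebra.ι F 1)

theorem X_rel : X a b ^ 2 - X a b = algebraMap F _ a := by
  have := RingQuot.mkAlgHom_rel F (SymbolRel.x (F := F) (p := 2) (a := a) (b := b))
  rw [map_sub, map_pow, AlgHom.commutes] at this
  exact this

theorem Y_rel : Y a b ^ 2 = algebraMap F _ b := by
  have := RingQuot.mkAlgHom_rel F (SymbolRel.y (F := F) (p := 2) (a := a) (b := b))
  rw [map_pow, AlgHom.commutes] at this
  exact this

theorem Y_X_rel : Y a b * X a b - X a b * Y a b = Y a b := by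
  have := RingQuot.mkAlgHom_rel F (SymbolRel.comm (F := F) (p := 2) (a := a) (b := b))
  rw [map_sub, map_mul, map_mul] at this
  exact this

variable {A : Type*} [Ring A] [Algebra F A]

/-- A pair of elements satisfying the relations of a symbol algebra induces a homomorphism. -/
def lift (x y : A) (hx : x ^ 2 - x = algebraMap F A a) (hy : y ^ 2 = algebraMap F A b)
    (hyx : y * x - x * y = y) : SymbolAlg F 2 a b →ₐ[F] A :=
  RingQuot.liftAlgHom F ⟨FreeAlgebra.lift F ![x, y], by
    rintro _ _ (_ | _ | _)
    · simpa using hx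
    · simpa using hy
    · simpa using hyx⟩

section Lift

variable {x y : A} (hx : x ^ 2 - x = algebraMap F A a) (hy : y ^ 2 = algebraMap F A b)
    (hyx : y * x - x * y = y)

@[simp] theorem lift_X : lift x y hx hy hyx (X a b) = x := by
  simp [lift, X]

@[simp] theorem lift_Y : lift x y hx hy hyx (Y a b) = y := by
  simp [lift, Y]

end Lift

theorem algHom_ext {f g : SymbolAlg F 2 a b →ₐ[F] A} (hX : f (X a b) = g (X a b))
    (hY : f (Y a b) = g (Y a b)) : f = g := by
  refine RingQuot.ringQuot_ext' _ _ _ (FreeAlgebra.hom_ext (funext fun i ↦ ?_))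
  fin_cases i
  · exact hX
  · exact hY

theorem commute_of_generators (f : SymbolAlg F 2 a b →ₐ[F] A) (z : A)
    (hX : Commute (f (X a b)) z) (hY : Commute (f (Y a b)) z) (q : SymbolAlg F 2 a b) :
    Commute (f q) z := by
  obtain ⟨w, rfl⟩ := RingQuot.mkAlgHom_surjective F _ q
  induction w with
  | grade0 r => rw [AlgHom.commutes, AlgHom.commutes]; exact Algebra.commute_algebraMap_left r z
  | grade1 i =>
    fin_cases i
    · exact hX
    · exact hY
  | mul p q hp hq => rw [map_mul, map_mul]; exact hp.mul_left hq
  | add p q hp hq => rw [map_add, map_add]; exact hp.add_left hq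

variable [CharP F 2]

open scoped Quaternion

/-- In characteristic two, a symbol algebra is a generalised quaternion algebra. -/
noncomputable def equivQuaternion (a b : F) : SymbolAlg F 2 a b ≃ₐ[F] ℍ[F,a,1,b] :=
  have h2 : (2 : F) = 0 := CharTwo.two_eq_zero
  AlgEquiv.ofAlgHom
    (lift ⟨0, 1, 0, 0⟩ ⟨0, 0, 1, 0⟩
      (by ext <;> simp [sq]) (by ext <;> simp [sq])
      (by ext <;> simp; linear_combination (-1 : F) * h2))
    (QuaternionAlgebra.lift
      { i := X a b
        j := Y a b
        k := X a b * Y a b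
        i_mul_i := by
          have := X_rel (a := a) (b := b)
          rw [sub_eq_iff_eq_add, sq] at this
          rw [this, Algebra.algebraMap_eq_smul_one, one_smul]
        j_mul_j := by rw [← sq, Y_rel, Algebra.algebraMap_eq_smul_one]
        i_mul_j := rfl
        j_mul_i := by
          rw [one_smul, sub_eq_add_neg, neg_eq_self_of_charTwo F, ← sub_eq_iff_eq_add, Y_X_rel] })
    (by
      refine QuaternionAlgebra.hom_ext ?_ ?_ <;>
        simp [QuaternionAlgebra.lift, QuaternionAlgebra.Basis.lift])
    (by
      refine algHom_ext ?_ ?_ <;>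
        simp [QuaternionAlgebra.lift, QuaternionAlgebra.Basis.lift])

instance : Module.Finite F (SymbolAlg F 2 a b) :=
  Module.Finite.equiv (equivQuaternion a b).symm.toLinearEquiv

theorem finrank_eq (a b : F) : Module.finrank F (SymbolAlg F 2 a b) = 4 := by
  rw [(equivQuaternion a b).toLinearEquiv.finrank_eq, QuaternionAlgebra.finrank_eq_four]

theorem isCentral_quaternion (hb : b ≠ 0) : Algebra.IsCentral F ℍ[F,a,1,b] where
  out q hq := by
    rw [Subalgebra.mem_center_iff] at hq
    have h1 := hq ⟨0, 1, 0, 0⟩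
    have h2 := hq ⟨0, 0, 1, 0⟩
    simp only [QuaternionAlgebra.ext_iff, QuaternionAlgebra.re_mul, QuaternionAlgebra.imI_mul,
      QuaternionAlgebra.imJ_mul, QuaternionAlgebra.imK_mul] at h1 h2
    have hs : q.imI = 0 := by linear_combination h2.2.2.1
    have hk : q.imK = 0 := by
      refine (mul_eq_zero.1 ?_).resolve_left hb
      linear_combination h2.1
    have hj : q.imJ = 0 := by
      linear_combination (-1 : F) * h1.2.2.1 + a * q.imK * CharTwo.two_eq_zero (R := F)
    refine Algebra.mem_bot.2 ⟨q.re, ?_⟩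
    ext <;> simp [hs, hj, hk]

theorem isSimpleRing_quaternion (hb : b ≠ 0) : IsSimpleRing ℍ[F,a,1,b] := by
  have h2 : (2 : F) = 0 := CharTwo.two_eq_zero
  have : Nontrivial ℍ[F,a,1,b] := ⟨⟨0, 1, fun h ↦ by
    have := congr_arg QuaternionAlgebra.re h
    simp at this⟩⟩
  have key : ∀ I : TwoSidedIdeal ℍ[F,a,1,b], ∀ q ∈ I, q ≠ 0 → (1 : ℍ[F,a,1,b]) ∈ I := by
    intro I q hq hq0
    have hsmul : ∀ (c : F) (x : ℍ[F,a,1,b]), x ∈ I → c • x ∈ I := fun c x hx ↦ by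
      rw [Algebra.smul_def]; exact I.mul_mem_left _ _ hx
    have hc : ∀ c : F, c ≠ 0 → (⟨c, 0, 0, 0⟩ : ℍ[F,a,1,b]) ∈ I → (1 : ℍ[F,a,1,b]) ∈ I := by
      intro c hc0 h
      convert hsmul c⁻¹ _ h using 1
      ext <;> simp [hc0]
    have hcj : ∀ c : F, c ≠ 0 → (⟨0, 0, c, 0⟩ : ℍ[F,a,1,b]) ∈ I → (1 : ℍ[F,a,1,b]) ∈ I := by
      intro c hc0 h
      refine hc (c * b) (mul_ne_zero hc0 hb) ?_
      convert I.mul_mem_right _ (⟨0, 0, 1, 0⟩ : ℍ[F,a,1,b]) h using 1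
      ext <;> simp; ring
    have had : ∀ x y : ℍ[F,a,1,b], x ∈ I → x * y - y * x ∈ I := fun x y hx ↦
      I.sub_mem (I.mul_mem_right _ _ hx) (I.mul_mem_left _ _ hx)
    obtain ⟨r, s, t, w⟩ := q
    have h1 : (⟨w * b, 0, s, 0⟩ : ℍ[F,a,1,b]) ∈ I := by
      convert had _ (⟨0, 0, 1, 0⟩ : ℍ[F,a,1,b]) hq using 1
      ext <;> simp
      · linear_combination (w * b) * h2
      · linear_combination (-b * w) * h2
      · linear_combination s * h2
      · linear_combination (-s) * h2
    have h3 : (⟨0, 0, s, 0⟩ : ℍ[F,a,1,b]) ∈ I := by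
      convert had _ (⟨0, 1, 0, 0⟩ : ℍ[F,a,1,b]) h1 using 1
      ext <;> simp
      linear_combination s * h2
    by_cases hs : s = 0
    · subst hs
      by_cases hw : w = 0
      · subst hw
        have h4 : (⟨0, 0, t, 0⟩ : ℍ[F,a,1,b]) ∈ I := by
          convert had _ (⟨0, 1, 0, 0⟩ : ℍ[F,a,1,b]) hq using 1
          ext <;> simp
          linear_combination t * h2
        by_cases ht : t = 0
        · subst ht
          refine hc r ?_ hq
          rintro rfl
          exact hq0 rfl
        · exact hcj t ht h4
      · exact hc _ (mul_ne_zero hw hb) h1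
    · exact hcj s hs h3
  refine ⟨⟨fun I ↦ ?_⟩⟩
  by_cases hI : I = ⊥
  · exact Or.inl hI
  · right
    obtain ⟨q, hq, hq0⟩ : ∃ q ∈ I, q ≠ 0 := by
      by_contra! h
      refine hI (le_antisymm (fun x hx ↦ ?_) bot_le)
      rw [h x hx]
      exact zero_mem _
    have := key I q hq hq0
    refine le_antisymm le_top fun x _ ↦ ?_
    simpa using I.mul_mem_left x 1 this

theorem isCentral (a : F) (hb : b ≠ 0) : Algebra.IsCentral F (SymbolAlg F 2 a b) :=
  have := isCentral_quaternion (a := a) hb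
  .of_algEquiv F _ _ (equivQuaternion a b).symm

theorem isSimpleRing (a : F) (hb : b ≠ 0) : IsSimpleRing (SymbolAlg F 2 a b) :=
  have := isSimpleRing_quaternion (a := a) hb
  .of_ringEquiv (equivQuaternion a b).symm.toRingEquiv ‹_›

end SymbolAlg
end Symbol

namespace SymbolAlg

section Relations

variable {F : Type} {R : Type*} [Field F] [Ring R] [Algebra F R] {a b : F}
  (f : SymbolAlg F 2 a b →ₐ[F] R)

theorem map_X_mul_X : f (X a b) * f (X a b) = f (X a b) + algebraMap F R a := by
  rw [← map_mul, ← sq, ← f.commutes, ← X_rel (a := a) (b := b), ← map_add]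
  congr 1; abel

theorem map_Y_mul_Y : f (Y a b) * f (Y a b) = algebraMap F R b := by
  rw [← map_mul, ← sq, Y_rel, f.commutes]

theorem map_Y_mul_X : f (Y a b) * f (X a b) = f (X a b) * f (Y a b) + f (Y a b) := by
  rw [← map_mul, ← map_mul, ← map_add]
  nth_rw 3 [← Y_X_rel]
  congr 1; abel

end Relations

end SymbolAlg

section SymbolClass

variable {F : Type} [Field F] [CharP F 2]

/-- The Brauer class of the quaternion algebra `[a,b)` for `b ≠ 0`. -/
noncomputable def symClass (a : F) (b : Fˣ) : BrauerGroup.{0, 0} F :=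
  have := SymbolAlg.isCentral a b.ne_zero
  have := SymbolAlg.isSimpleRing a b.ne_zero
  brauerClass F (SymbolAlg F 2 a b)

theorem symClass_eq_one_of_matrix {a : F} {b : Fˣ} (x y : Matrix (Fin 2) (Fin 2) F)
    (hx : x ^ 2 - x = algebraMap F _ a) (hy : y ^ 2 = algebraMap F _ (b : F))
    (hyx : y * x - x * y = y) : symClass a b = 1 :=
  have := SymbolAlg.isCentral a b.ne_zero
  have := SymbolAlg.isSimpleRing a b.ne_zero
  brauerClass_eq_one_of_algHom (SymbolAlg.lift x y hx hy hyx) (SymbolAlg.finrank_eq a b)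

theorem symClass_eq_one_of_norm {a : F} {b : Fˣ} (u v : F) (h : u ^ 2 + u * v + a * v ^ 2 = b) :
    symClass a b = 1 := by
  have h2 : (2 : F) = 0 := CharTwo.two_eq_zero
  refine symClass_eq_one_of_matrix !![0, a; 1, 1] !![u, u + v * a; v, u] ?_ ?_ ?_
  all_goals
    ext i j
    fin_cases i <;> fin_cases j <;> simp [sq, Matrix.mul_apply, Matrix.algebraMap_eq_diagonal]
  all_goals grind

theorem symClass_eq_one_of_artinSchreier (a : F) (b : Fˣ) : symClass (a ^ 2 + a) b = 1 := by
  have h2 : (2 : F) = 0 := CharTwo.two_eq_zero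
  refine symClass_eq_one_of_matrix !![a, 0; 0, a + 1] !![0, (b : F); 1, 0] ?_ ?_ ?_
  all_goals
    ext i j
    fin_cases i <;> fin_cases j <;> simp [sq, Matrix.mul_apply, Matrix.algebraMap_eq_diagonal]
  all_goals grind

namespace SymbolAlg

variable {R : Type*} [Ring R] [Algebra F R] {a b c d : F}

theorem exists_commuting_algHom (f₁ : SymbolAlg F 2 a b →ₐ[F] R) (f₂ : SymbolAlg F 2 c d →ₐ[F] R)
    (h : ∀ p q, Commute (f₁ p) (f₂ q)) :
    ∃ (f : SymbolAlg F 2 (a + c) b →ₐ[F] R) (g : SymbolAlg F 2 c (b * d) →ₐ[F] R),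
      ∀ p q, Commute (f p) (g q) := by
  have hX₁ := map_X_mul_X f₁
  have hX₂ := map_X_mul_X f₂
  have hY₁ := map_Y_mul_Y f₁
  have hY₂ := map_Y_mul_Y f₂
  have hYX₁ := map_Y_mul_X f₁
  have hYX₂ := map_Y_mul_X f₂
  have hXX := (h (X a b) (X c d)).eq
  have hXY := (h (X a b) (Y c d)).eq
  have hYX := (h (Y a b) (X c d)).eq
  have hYY := (h (Y a b) (Y c d)).eq
  generalize f₁ (X a b) = x₁ at *
  generalize f₁ (Y a b) = y₁ at *
  generalize f₂ (X c d) = x₂ at *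
  generalize f₂ (Y c d) = y₂ at *
  have h2 := add_self_of_charTwo F (M := R)
  have hfx : (x₁ + x₂) ^ 2 - (x₁ + x₂) = algebraMap F R (a + c) := by
    have : (x₁ + x₂) ^ 2 = x₁ * x₁ + x₂ * x₂ + (x₂ * x₁ + x₁ * x₂) := by noncomm_ring
    rw [this, hXX, h2, hX₁, hX₂, map_add]
    abel
  have hfyx : y₁ * (x₁ + x₂) - (x₁ + x₂) * y₁ = y₁ := by
    rw [mul_add, add_mul, hYX₁, hYX]
    abel
  have hgy : (y₁ * y₂) ^ 2 = algebraMap F R (b * d) := by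
    rw [sq, mul_assoc, ← mul_assoc y₂, ← hYY, mul_assoc, hY₂, ← mul_assoc, hY₁, map_mul]
  have hgyx : y₁ * y₂ * x₂ - x₂ * (y₁ * y₂) = y₁ * y₂ := by
    rw [mul_assoc, hYX₂, ← mul_assoc x₂, ← hYX, mul_add, mul_assoc]
    abel
  refine ⟨lift (x₁ + x₂) y₁ hfx (by rw [sq, hY₁]) hfyx,
    lift x₂ (y₁ * y₂) (by rw [sq, hX₂]; abel) hgy hgyx, fun p q ↦ ?_⟩
  refine commute_of_generators _ _ (Commute.symm ?_) (Commute.symm ?_) p <;>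
    refine commute_of_generators _ _ ?_ ?_ q <;> simp only [lift_X, lift_Y]
  · exact (Commute.add_left hXX (.refl _)).symm
  · change y₁ * y₂ * (x₁ + x₂) = (x₁ + x₂) * (y₁ * y₂)
    have e : y₁ * y₂ * (x₁ + x₂) = y₁ * (y₂ * x₁) + y₁ * (y₂ * x₂) := by noncomm_ring
    rw [e, ← hXY, hYX₂, ← mul_assoc, hYX₁, mul_add, ← mul_assoc y₁ x₂, hYX, add_mul, add_mul,
      ← mul_assoc, ← mul_assoc]
    have := h2 (y₁ * y₂)
    rw [add_assoc, add_left_comm (y₁ * y₂), this, add_zero]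
  · exact Commute.symm hYX
  · exact Commute.mul_left (.refl _) (Commute.symm hYY)

end SymbolAlg

theorem symClass_mul_symClass (a c : F) (b d : Fˣ) :
    symClass a b * symClass c d = symClass (a + c) b * symClass c (b * d) := by
  have := SymbolAlg.isCentral a b.ne_zero
  have := SymbolAlg.isSimpleRing a b.ne_zero
  have := SymbolAlg.isCentral c d.ne_zero
  have := SymbolAlg.isSimpleRing c d.ne_zero
  have := SymbolAlg.isCentral (a + c) b.ne_zero
  have := SymbolAlg.isSimpleRing (a + c) b.ne_zero
  have := SymbolAlg.isCentral c (b * d).ne_zero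
  have := SymbolAlg.isSimpleRing c (b * d).ne_zero
  obtain ⟨f, g, h⟩ := SymbolAlg.exists_commuting_algHom
    (R := SymbolAlg F 2 a (b : F) ⊗[F] SymbolAlg F 2 c (d : F))
    Algebra.TensorProduct.includeLeft Algebra.TensorProduct.includeRight fun p q ↦ by
      simp [Commute, SemiconjBy]
  exact (brauerClass_mul_eq_mul (f := f) (g := g) h (by simp [SymbolAlg.finrank_eq])).symm

theorem symClass_mul_eq_symClass_mul {s t : Fˣ} (h : (s : F) + t = 1) (a : F) :
    symClass (a * s) s = symClass (a * t) t := by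
  have := SymbolAlg.isCentral (a * s) s.ne_zero
  have := SymbolAlg.isSimpleRing (a * s) s.ne_zero
  have := SymbolAlg.isCentral (a * t) t.ne_zero
  have := SymbolAlg.isSimpleRing (a * t) t.ne_zero
  have hX := SymbolAlg.map_X_mul_X (AlgHom.id F (SymbolAlg F 2 (a * s) (s : F)))
  have hY := SymbolAlg.map_Y_mul_Y (AlgHom.id F (SymbolAlg F 2 (a * s) (s : F)))
  have hYX := SymbolAlg.map_Y_mul_X (AlgHom.id F (SymbolAlg F 2 (a * s) (s : F)))
  have h2 := add_self_of_charTwo F (M := SymbolAlg F 2 (a * s) (s : F))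
  simp only [AlgHom.id_apply] at hX hY hYX
  generalize SymbolAlg.X (a * s) (s : F) = x at *
  generalize SymbolAlg.Y (a * s) (s : F) = y at *
  obtain ⟨z, hz⟩ : ∃ z, z = 1 + (s⁻¹ : F) • y := ⟨_, rfl⟩
  have hyz : y * z = y + 1 := by
    rw [hz, mul_add, mul_one, mul_smul_comm, hY, Algebra.algebraMap_eq_smul_one, smul_smul,
      inv_mul_cancel₀ s.ne_zero, one_smul]
  have hzy : z * y = y + 1 := by
    rw [hz, add_mul, one_mul, smul_mul_assoc, hY, Algebra.algebraMap_eq_smul_one, smul_smul,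
      inv_mul_cancel₀ s.ne_zero, one_smul]
  have hxz : x * z = z * x + (z + 1) := by
    have : z + 1 = (s⁻¹ : F) • y := by rw [hz, add_comm 1, add_assoc, h2, add_zero]
    rw [this, hz, mul_add, add_mul, mul_smul_comm, smul_mul_assoc, hYX, smul_add, add_assoc,
      add_assoc, h2, mul_one, one_mul, add_zero]
  have hzz : z * z = algebraMap F _ (t / s : F) := by
    have e : (t / s : F) = 1 + (s : F)⁻¹ := by
      rw [div_eq_iff s.ne_zero, add_mul, inv_mul_cancel₀ s.ne_zero, one_mul, ← h, ← add_assoc,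
        CharTwo.add_self_eq_zero, zero_add]
    nth_rw 1 [hz]
    rw [add_mul, one_mul, smul_mul_assoc, hyz, hz, smul_add, e, map_add, map_one,
      Algebra.algebraMap_eq_smul_one ((s : F)⁻¹), ← add_assoc, add_assoc 1, h2, add_zero]
  have hx' : (z * x) ^ 2 - z * x = algebraMap F _ (a * t) := by
    have e1 : z * x * (z * x) = z * (x * z) * x := by noncomm_ring
    have e2 : z * (z * x + (z + 1)) * x = z * z * (x * x + x) + z * x := by noncomm_ring
    rw [sq, e1, hxz, e2, add_sub_cancel_right, hX, hzz, add_right_comm, h2, zero_add, ← map_mul]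
    congr 1
    field_simp
  have hy' : (1 + y) ^ 2 = algebraMap F _ (t : F) := by
    have e : (1 + y) ^ 2 = 1 + y * y + (y + y) := by noncomm_ring
    rw [e, h2, hY, add_zero, ← map_one (algebraMap F _), ← map_add, ← h, add_right_comm,
      CharTwo.add_self_eq_zero, zero_add]
  have hyx' : (1 + y) * (z * x) - z * x * (1 + y) = 1 + y := by
    have e : (1 + y) * (z * x) - z * x * (1 + y) = y * z * x - z * (x * y) := by noncomm_ring
    have hxy : x * y = y * x + y := by rw [hYX, add_assoc, h2, add_zero]
    rw [e, hxy, mul_add, ← mul_assoc z, hyz, hzy, sub_add_cancel_left, neg_eq_self_of_charTwo F,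
      add_comm]
  exact (brauerClass_eq_of_algHom (SymbolAlg.lift _ _ hx' hy' hyx')
    (by rw [SymbolAlg.finrank_eq, SymbolAlg.finrank_eq])).symm

end SymbolClass

section SymbolLength

variable {F : Type} [Field F] [CharP F 2]

theorem symClass_mul_left (a c : F) (b : Fˣ) :
    symClass a b * symClass c b = symClass (a + c) b := by
  rw [symClass_mul_symClass, symClass_eq_one_of_norm (b := b * b) (b : F) 0 (by simp [sq]), mul_one]

theorem symClass_zero (b : Fˣ) : symClass 0 b = 1 := by
  simpa using symClass_eq_one_of_artinSchreier 0 b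

theorem symClass_mul_self (a : F) (b : Fˣ) : symClass a b * symClass a b = 1 := by
  rw [symClass_mul_left, CharTwo.add_self_eq_zero, symClass_zero]

theorem symClass_mul_right (a : F) (b d : Fˣ) :
    symClass a b * symClass a d = symClass a (b * d) := by
  rw [symClass_mul_symClass, CharTwo.add_self_eq_zero, symClass_zero, one_mul]

theorem symClass_mul_norm {a : F} (b : Fˣ) {w : Fˣ} (u v : F)
    (h : b * (u ^ 2 + u * v + a * v ^ 2) = w) : symClass a w = symClass a b := by
  have : w = b * (b⁻¹ * w) := by simp
  rw [this, ← symClass_mul_right, symClass_eq_one_of_norm (b := b⁻¹ * w) u v (by simp [← h]),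
    mul_one]

theorem symClass_eq_one_of_isotropic {a : F} (b : Fˣ) {u v : F} (huv : ¬(u = 0 ∧ v = 0))
    (h : u ^ 2 + u * v + a * v ^ 2 = 0) : symClass a b = 1 := by
  have hv : v ≠ 0 := by
    rintro rfl
    simp_all
  have : a = (u / v) ^ 2 + u / v := by
    field_simp
    grind
  rw [this, symClass_eq_one_of_artinSchreier]

/-- The sum of two symbols is a sum of two symbols with second slot of the first the sum of the
second slots. -/
theorem exists_symClass_mul_eq (α γ : F) (β δ σ : Fˣ) (h : (β : F) + δ = σ) :
    ∃ w, symClass α β * symClass γ δ = symClass (α + γ) σ * symClass w (β * δ) := by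
  obtain ⟨S, hS⟩ : ∃ S, S = β * σ⁻¹ := ⟨_, rfl⟩
  obtain ⟨T, hT⟩ : ∃ T, T = δ * σ⁻¹ := ⟨_, rfl⟩
  have hST : (S : F) + T = 1 := by
    rw [hS, hT, Units.val_mul, Units.val_mul, ← add_mul, h, Units.mul_inv]
  have h₁ : symClass α S = symClass (α * T) (S * T) := by
    have e : α = α * S + α * T := by rw [← mul_add, hST, mul_one]
    rw [mul_comm S, ← symClass_mul_right, ← symClass_mul_eq_symClass_mul hST, symClass_mul_left,
      ← e]
  have h₂ : symClass γ T = symClass (γ * S) (S * T) := by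
    rw [← symClass_mul_right, symClass_mul_eq_symClass_mul hST, symClass_mul_left, ← mul_add,
      add_comm (T : F), hST, mul_one]
  refine ⟨α * T + γ * S, ?_⟩
  have e₁ : β = σ * S := by simp [hS]
  have e₂ : δ = σ * T := by simp [hT]
  have e₃ : symClass (α * T + γ * S) (β * δ) = symClass (α * T + γ * S) (S * T) := by
    have : β * δ = (S * T) * (σ * σ) := by rw [e₁, e₂, mul_mul_mul_comm, mul_comm]
    rw [this, ← symClass_mul_right _ _ (σ * σ), ← symClass_mul_right _ σ σ, symClass_mul_self,
      mul_one]
  rw [e₃, e₁, e₂, ← symClass_mul_right, ← symClass_mul_right, h₁, h₂, mul_mul_mul_comm,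
    symClass_mul_left, symClass_mul_left]

/-- A Brauer class that is a product of `n` classes of quaternion algebras. -/
def IsSymbolProduct (n : ℕ) (c : BrauerGroup.{0, 0} F) : Prop :=
  ∃ (a : Fin n → F) (b : Fin n → Fˣ), c = ∏ i, symClass (a i) (b i)

theorem IsSymbolProduct.symClass_mul {n : ℕ} {c : BrauerGroup.{0, 0} F} (h : IsSymbolProduct n c)
    (a : F) (b : Fˣ) : IsSymbolProduct (n + 1) (symClass a b * c) := by
  obtain ⟨a', b', rfl⟩ := h
  exact ⟨Fin.cons a a', Fin.cons b b', by simp [Fin.prod_univ_succ]⟩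

theorem IsSymbolProduct.succ {n : ℕ} {c : BrauerGroup.{0, 0} F} (h : IsSymbolProduct n c) :
    IsSymbolProduct (n + 1) c := by
  simpa [symClass_zero] using h.symClass_mul 0 1

theorem isSymbolProduct_one : IsSymbolProduct 0 (1 : BrauerGroup.{0, 0} F) :=
  ⟨Fin.elim0, Fin.elim0, by simp⟩

theorem symbolProduct_trichotomy {n : ℕ} (a : Fin (n + 1) → F) (b : Fin (n + 1) → Fˣ)
    (u v : Fin (n + 1) → F) :
    IsSymbolProduct n (∏ i, symClass (a i) (b i)) ∨
    ((∀ i, u i = 0 ∧ v i = 0) ∧ ∃ (d : Fˣ) (r : BrauerGroup.{0, 0} F), IsSymbolProduct n r ∧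
      ∏ i, symClass (a i) (b i) = symClass (∑ i, a i) d * r) ∨
    ∃ (w : Fˣ) (r : BrauerGroup.{0, 0} F), IsSymbolProduct n r ∧
      (w : F) = ∑ i, b i * (u i ^ 2 + u i * v i + a i * v i ^ 2) ∧
      ∏ i, symClass (a i) (b i) = symClass (∑ i, a i) w * r := by
  have head (α u v : F) (β : Fˣ) : symClass α β = 1 ∨ (u = 0 ∧ v = 0) ∨
      ∃ w : Fˣ, (w : F) = β * (u ^ 2 + u * v + α * v ^ 2) ∧ symClass α β = symClass α w := by
    by_cases huv : u = 0 ∧ v = 0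
    · exact .inr (.inl huv)
    · by_cases h : u ^ 2 + u * v + α * v ^ 2 = 0
      · exact .inl (symClass_eq_one_of_isotropic β huv h)
      · exact .inr (.inr ⟨Units.mk0 _ (mul_ne_zero β.ne_zero h), rfl,
          (symClass_mul_norm β u v rfl).symm⟩)
  induction n with
  | zero =>
    obtain h | h | ⟨w, hw, h⟩ := head (a 0) (u 0) (v 0) (b 0)
    · left
      simpa [h] using isSymbolProduct_one
    · exact .inr (.inl ⟨by simpa using h, b 0, 1, isSymbolProduct_one, by simp⟩)
    · exact .inr (.inr ⟨w, 1, isSymbolProduct_one, by simpa using hw, by simpa using h⟩)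
  | succ n ih =>
    rw [Fin.prod_univ_succ, Fin.sum_univ_succ a, Fin.forall_fin_succ,
      Fin.sum_univ_succ fun i ↦ (b i : F) * (u i ^ 2 + u i * v i + a i * v i ^ 2)]
    specialize ih (fun i ↦ a i.succ) (fun i ↦ b i.succ) (fun i ↦ u i.succ) (fun i ↦ v i.succ)
    have hB (h : ∀ i : Fin (n + 1), u i.succ = 0 ∧ v i.succ = 0) : ∑ i : Fin (n + 1),
        (b i.succ : F) * (u i.succ ^ 2 + u i.succ * v i.succ + a i.succ * v i.succ ^ 2) = 0 :=
      Finset.sum_eq_zero fun i _ ↦ by simp [h i]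
    generalize (∏ i : Fin (n + 1), symClass (a i.succ) (b i.succ)) = P at *
    generalize (∑ i : Fin (n + 1), a i.succ) = s at *
    generalize (∑ i : Fin (n + 1), (b i.succ : F) * _) = B at *
    specialize head (a 0) (u 0) (v 0) (b 0)
    generalize a 0 = α at *
    generalize b 0 = β at *
    obtain ih | ⟨ih, d, r, hr, rfl⟩ | ⟨d, r, hr, hd, rfl⟩ := ih
    · exact .inl (ih.symClass_mul _ _)
    · obtain h | h | ⟨w, hw, h⟩ := head
      · left
        rw [h, one_mul]
        exact hr.symClass_mul _ _
      · refine .inr (.inl ⟨⟨h, ih⟩, β, _, hr.symClass_mul s (β * d), ?_⟩)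
        rw [← mul_assoc, symClass_mul_symClass, mul_assoc]
      · refine .inr (.inr ⟨w, _, hr.symClass_mul s (w * d), ?_, ?_⟩)
        · rw [hB ih, hw, add_zero]
        · rw [h, ← mul_assoc, symClass_mul_symClass, mul_assoc]
    · obtain h | h | ⟨w, hw, h⟩ := head
      · left
        rw [h, one_mul]
        exact hr.symClass_mul _ _
      · refine .inr (.inr ⟨d, _, hr.symClass_mul α (d * β), ?_, ?_⟩)
        · simp [h, hd]
        · rw [← mul_assoc, mul_comm (symClass α β), symClass_mul_symClass, mul_assoc, add_comm]
      · by_cases hwd : (w : F) + d = 0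
        · left
          have : w = d := Units.ext (CharTwo.add_eq_zero.1 hwd)
          rw [h, this, ← mul_assoc, symClass_mul_left]
          exact hr.symClass_mul _ _
        · obtain ⟨c, hc⟩ := exists_symClass_mul_eq α s w d (Units.mk0 _ hwd) rfl
          refine .inr (.inr ⟨Units.mk0 _ hwd, _, hr.symClass_mul c (w * d), by simp [hw, hd], ?_⟩)
          rw [h, ← mul_assoc, hc, mul_assoc]

theorem IsSymbolProduct.pred {n : ℕ} {c : BrauerGroup.{0, 0} F} (h : IsSymbolProduct (n + 1) c)
    (hiso : ∀ a b : Fin (n + 2) → F, ¬ AnisoBin F a b) : IsSymbolProduct n c := by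
  obtain ⟨a, b, rfl⟩ := h
  have := hiso (Fin.cons 1 fun i ↦ (b i : F)⁻¹) (Fin.cons (∑ i, a i) fun i ↦ a i * b i)
  simp only [AnisoBin, not_forall] at this
  obtain ⟨z, hz, hz0⟩ := this
  have hform : (∑ i, (b i : F) * (((z i.succ).1 / b i) ^ 2 +
      (z i.succ).1 / b i * (z i.succ).2 + a i * (z i.succ).2 ^ 2)) =
      (z 0).1 ^ 2 + (z 0).1 * (z 0).2 + (∑ i, a i) * (z 0).2 ^ 2 := by
    rw [← CharTwo.add_eq_zero, add_comm, ← hz, binSum, Fin.sum_univ_succ (n := n + 1)]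
    simp only [Fin.cons_zero, Fin.cons_succ, one_mul]
    congr 1
    refine Finset.sum_congr rfl fun i _ ↦ ?_
    field_simp
  obtain h | ⟨h, d, r, hr, e⟩ | ⟨w, r, hr, hw, e⟩ := symbolProduct_trichotomy a b
    (fun i ↦ (z i.succ).1 / b i) (fun i ↦ (z i.succ).2)
  · exact h
  · rw [e, symClass_eq_one_of_isotropic d (u := (z 0).1) (v := (z 0).2), one_mul]
    · exact hr
    · rintro ⟨h1, h2⟩
      refine hz0 (funext fun i ↦ ?_)
      refine Fin.cases (Prod.ext h1 h2) (fun i ↦ ?_) i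
      have := h i
      exact Prod.ext (by simpa using this.1) this.2
    · rw [← hform]
      refine Finset.sum_eq_zero fun i _ ↦ ?_
      simp [(h i).1, (h i).2]
  · rw [hform] at hw
    rw [e, symClass_eq_one_of_norm _ _ hw.symm, one_mul]
    exact hr

theorem IsSymbolProduct.le {u n : ℕ} {c : BrauerGroup.{0, 0} F} (h : IsSymbolProduct n c)
    (hu₁ : ∀ (n : ℕ) (a b : Fin n → F), AnisoBin F a b → 2 * n ≤ u) :
    ∃ m ≤ u / 2 - 1, IsSymbolProduct m c := by
  induction n with
  | zero => exact ⟨0, by simp, h⟩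
  | succ n ih =>
    by_cases hn : n + 1 ≤ u / 2 - 1
    · exact ⟨_, hn, h⟩
    · refine ih (h.pred fun a b hab ↦ ?_)
      have := hu₁ _ a b hab
      omega

end SymbolLength

section MatrixTrace

variable {n : Type*} [Fintype n] [DecidableEq n] {K : Type*}

theorem Matrix.trace_sq_of_charTwo [CommRing K] [CharP K 2] (M : Matrix n n K) :
    (M * M).trace = M.trace ^ 2 := by
  induction M using Matrix.induction_on' with
  | h_zero => simp
  | h_add p q hp hq =>
    have : ((p + q) * (p + q)).trace =
        (p * p).trace + (q * q).trace + ((p * q).trace + (q * p).trace) := by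
      rw [← Matrix.trace_add, ← Matrix.trace_add, ← Matrix.trace_add]
      congr 1
      noncomm_ring
    rw [this, Matrix.trace_mul_comm q p, CharTwo.add_self_eq_zero, hp, hq, Matrix.trace_add,
      CharTwo.add_sq, add_zero]
  | h_std_basis i j x =>
    obtain rfl | h := eq_or_ne i j
    · simp [sq]
    · simp [h, h.symm]

theorem Matrix.exists_eq_mul_trace [Field K] (φ : Matrix n n K →ₗ[K] K)
    (hφ : ∀ X Y, φ (X * Y) = φ (Y * X)) : ∃ k, ∀ X, φ X = k * X.trace := by
  obtain h | ⟨⟨i₀⟩⟩ := isEmpty_or_nonempty n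
  · exact ⟨0, fun X ↦ by rw [Subsingleton.elim X 0]; simp⟩
  refine ⟨φ (Matrix.single i₀ i₀ 1), fun X ↦ ?_⟩
  induction X using Matrix.induction_on' with
  | h_zero => simp
  | h_add p q hp hq => rw [map_add, hp, hq, Matrix.trace_add, mul_add]
  | h_std_basis i j x =>
    obtain rfl | h := eq_or_ne i j
    · have h1 : Matrix.single i i x = Matrix.single i i₀ x * Matrix.single i₀ i 1 := by simp
      have h2 : Matrix.single i₀ i 1 * Matrix.single i i₀ x =
        x • Matrix.single i₀ i₀ (1 : K) := by simp
      rw [h1, hφ, h2, map_smul]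
      simp [mul_comm]
    · have h1 : Matrix.single i j x = Matrix.single i i x * Matrix.single i j 1 := by simp
      rw [h1, hφ]
      simp [h, h.symm]

end MatrixTrace

section ReducedTrace

variable {F : Type} [Field F] {A : Type} [Ring A] [Algebra F A] [FiniteDimensional F A]
  [IsSimpleRing A] [Algebra.IsCentral F A]

/-- In characteristic two, a central simple algebra carries a nonzero trace form compatible with
squaring. -/
theorem exists_reducedTrace [CharP F 2] : ∃ t : A →ₗ[F] F, t ≠ 0 ∧ (∀ a b, t (a * b) = t (b * a)) ∧
    ∀ a, t (a * a) = t a ^ 2 := by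
  let K := AlgebraicClosure F
  have := isCentral_baseChange (F := F) (A := A) K
  have := isSimpleRing_baseChange (F := F) (A := A) K
  have : CharP K 2 := charP_of_injective_algebraMap (algebraMap F K).injective 2
  obtain ⟨n, hn, ⟨e⟩⟩ := IsSimpleRing.exists_algEquiv_matrix_of_isAlgClosed K (K ⊗[F] A)
  let C : Submodule F A := Submodule.span F {x | ∃ a b, x = a * b - b * a}
  obtain ⟨a₀, ha₀⟩ : ∃ a₀, a₀ ∉ C := by
    by_contra! h
    have h0 : ∀ z : K ⊗[F] A, (e z).trace = 0 := by
      intro z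
      induction z with
      | zero => simp
      | add x y hx hy => simp [hx, hy]
      | tmul c a =>
        have h1 : ((e (1 ⊗ₜ a)).trace : K) = 0 := by
          induction h a using Submodule.span_induction with
          | mem x hx =>
            obtain ⟨a, b, rfl⟩ := hx
            have h2 : (1 : K) ⊗ₜ[F] (a * b - b * a) =
                (1 ⊗ₜ a) * (1 ⊗ₜ b) - (1 ⊗ₜ b) * (1 ⊗ₜ a) := by
              simp [TensorProduct.tmul_sub]
            rw [h2, map_sub, map_mul, map_mul, Matrix.trace_sub, Matrix.trace_mul_comm, sub_self]
          | zero => simp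
          | add x y _ _ hx hy => simp [TensorProduct.tmul_add, hx, hy]
          | smul c x _ hx =>
            rw [TensorProduct.tmul_smul, ← algebraMap_smul K c, map_smul, Matrix.trace_smul, hx,
              smul_zero]
        have h2 : c ⊗ₜ[F] a = c • ((1 : K) ⊗ₜ[F] a) := by simp [TensorProduct.smul_tmul']
        rw [h2, map_smul, Matrix.trace_smul, h1, smul_zero]
    let i : Fin n := 0
    have := h0 (e.symm (Matrix.single i i 1))
    simp at this
  obtain ⟨t, ht1, htC⟩ := Submodule.exists_dual_map_eq_bot_of_notMem ha₀ inferInstance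
  have hcomm (a b) : t (a * b) = t (b * a) := by
    rw [← sub_eq_zero, ← map_sub, ← Submodule.mem_bot F, ← htC]
    exact Submodule.mem_map_of_mem (Submodule.subset_span ⟨a, b, rfl⟩)
  let tK : K ⊗[F] A →ₗ[K] K := LinearMap.liftBaseChange K ((Algebra.linearMap F K).comp t)
  have htK (c a) : tK (c ⊗ₜ a) = c * algebraMap F K (t a) := by simp [tK]
  have hKcomm (x y) : tK (x * y) = tK (y * x) := by
    induction x with
    | zero => simp
    | add x₁ x₂ h₁ h₂ => simp [add_mul, mul_add, h₁, h₂]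
    | tmul c a =>
      induction y with
      | zero => simp
      | add x₁ x₂ h₁ h₂ => simp [add_mul, mul_add, h₁, h₂]
      | tmul d b => simp [htK, hcomm a b, mul_comm c d]
  obtain ⟨k, hk⟩ := Matrix.exists_eq_mul_trace (tK ∘ₗ e.symm.toLinearMap) fun X Y ↦ by
    simp [hKcomm]
  have hk' (a) : algebraMap F K (t a) = k * (e (1 ⊗ₜ a)).trace := by
    rw [← hk]
    simp [htK]
  have hsq (a) : algebraMap F K (t a) ^ 2 = k * algebraMap F K (t (a * a)) := by
    have : (1 : K) ⊗ₜ[F] (a * a) = (1 ⊗ₜ a) * (1 ⊗ₜ a) := by simp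
    rw [hk', hk', this, map_mul, Matrix.trace_sq_of_charTwo]
    ring
  have hr : t (a₀ * a₀) ≠ 0 := fun h ↦ by
    have := hsq a₀
    simp [h] at this
    exact ht1 this
  obtain ⟨r, hr', hrk⟩ : ∃ r : F, r ≠ 0 ∧ k = algebraMap F K r := by
    refine ⟨t a₀ ^ 2 / t (a₀ * a₀), div_ne_zero (pow_ne_zero _ ht1) hr, ?_⟩
    rw [map_div₀, map_pow, hsq, mul_div_cancel_right₀]
    simpa using hr
  have hsq' (a) : t a ^ 2 = r * t (a * a) := by
    have := hsq a
    rw [hrk, ← map_pow, ← map_mul] at this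
    exact (algebraMap F K).injective this
  refine ⟨r⁻¹ • t, ?_, fun a b ↦ by simp [hcomm a b], fun a ↦ ?_⟩
  · intro h
    have := LinearMap.congr_fun h a₀
    simp [hr'] at this
    exact ht1 this
  · simp only [LinearMap.smul_apply, smul_eq_mul, mul_pow, hsq']
    field_simp
end ReducedTrace

section SymmetricTensor

variable {F V ι : Type*} [Field F] [AddCommGroup V] [Module F V]

theorem TensorProduct.exists_eq_sum_add_of_comm_eq [Fintype ι] [LinearOrder ι]
    (e : Module.Basis ι F V) (z : V ⊗[F] V) (hz : TensorProduct.comm F V V z = z) :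
    ∃ (c : ι → F) (y : V ⊗[F] V),
      z = ∑ i, c i • (e i ⊗ₜ e i) + (y + TensorProduct.comm F V V y) := by
  let E := e.tensorProduct e
  have hsymm (i j) : E.repr z (i, j) = E.repr z (j, i) := by
    have key (w : V ⊗[F] V) : E.repr (TensorProduct.comm F V V w) (i, j) = E.repr w (j, i) := by
      induction w with
      | zero => simp
      | add x y hx hy => simp [hx, hy]
      | tmul x y => simp [E, mul_comm]
    rw [← key, hz]
  let y : V ⊗[F] V := ∑ p : ι × ι, if p.1 < p.2 then E.repr z p • (e p.1 ⊗ₜ e p.2) else 0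
  refine ⟨fun i ↦ E.repr z (i, i), y, ?_⟩
  have hy : TensorProduct.comm F V V y =
      ∑ p : ι × ι, if p.2 < p.1 then E.repr z p • (e p.1 ⊗ₜ e p.2) else 0 := by
    rw [map_sum, ← Equiv.sum_comp (Equiv.prodComm ι ι)]
    refine Finset.sum_congr rfl fun p _ ↦ ?_
    obtain ⟨i, j⟩ := p
    by_cases h : j < i <;> simp [h, hsymm i j]
  have hd : ∑ i, E.repr z (i, i) • (e i ⊗ₜ e i) =
      ∑ p : ι × ι, if p.1 = p.2 then E.repr z p • (e p.1 ⊗ₜ[F] e p.2) else 0 := by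
    rw [Fintype.sum_prod_type]
    simp
  rw [hy, hd, ← Finset.sum_add_distrib, ← Finset.sum_add_distrib]
  conv_lhs => rw [← E.sum_repr z]
  refine Finset.sum_congr rfl fun p _ ↦ ?_
  obtain ⟨i, j⟩ := p
  rcases lt_trichotomy i j with h | h | h
  · simp [h, h.ne, h.not_gt, E]
  · simp [h, E]
  · simp [h, h.ne', h.not_gt, E]

end SymmetricTensor

section Goldman

variable (F A : Type) [Field F] [Ring A] [Algebra F A]

/-- The map `A ⊗ A → End A` sending `a ⊗ b` to `c ↦ a c b`. -/
noncomputable def sandwich : A ⊗[F] A →ₗ[F] A →ₗ[F] A :=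
  (AlgHom.mulLeftRight F A).toLinearMap ∘ₗ
    (TensorProduct.congr (.refl F A) (MulOpposite.opLinearEquiv F)).toLinearMap

variable {F A}

@[simp] theorem sandwich_tmul (a b c : A) : sandwich F A (a ⊗ₜ b) c = a * c * b := by
  simp [sandwich, AlgHom.mulLeftRight_apply]

theorem sandwich_mul_tmul (z : A ⊗[F] A) (a b c : A) :
    sandwich F A (z * a ⊗ₜ b) c = sandwich F A z (a * c) * b := by
  induction z with
  | zero => simp
  | add x y hx hy => simp [add_mul, hx, hy]
  | tmul x y => simp [mul_assoc]

theorem sandwich_tmul_mul (z : A ⊗[F] A) (a b c : A) :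
    sandwich F A (a ⊗ₜ b * z) c = a * sandwich F A z (c * b) := by
  induction z with
  | zero => simp
  | add x y hx hy => simp [mul_add, hx, hy]
  | tmul x y => simp [mul_assoc]

variable [FiniteDimensional F A] [IsSimpleRing A] [Algebra.IsCentral F A]

theorem sandwich_bijective : Function.Bijective (sandwich F A) := by
  have : IsSimpleRing (A ⊗[F] Aᵐᵒᵖ) := isSimpleRing_tensorProduct
  have h := AlgHom.bijective_of_finrank_eq (AlgHom.mulLeftRight F A) (by
    rw [Module.finrank_tensorProduct, Module.finrank_linearMap,
      (MulOpposite.opLinearEquiv F : A ≃ₗ[F] Aᵐᵒᵖ).finrank_eq])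
  exact h.comp (TensorProduct.congr (.refl F A) (MulOpposite.opLinearEquiv F)).bijective

theorem exists_goldman [CharP F 2] : ∃ g : A ⊗[F] A, g * g = 1 ∧
    (∀ z, g * z = Algebra.TensorProduct.comm F A A z * g) ∧
      Algebra.TensorProduct.comm F A A g = g := by
  obtain ⟨t, ht0, hcomm, hsq⟩ := exists_reducedTrace (F := F) (A := A)
  obtain ⟨a₀, ha₀⟩ : ∃ a, t a ≠ 0 := by
    by_contra! h
    exact ht0 (LinearMap.ext h)
  obtain ⟨g, hg⟩ := sandwich_bijective.2 ((Algebra.linearMap F A).comp t)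
  have hg' (c) : sandwich F A g c = algebraMap F A (t c) := by rw [hg]; rfl
  have ext {x y : A ⊗[F] A} (h : ∀ c, sandwich F A x c = sandwich F A y c) : x = y :=
    sandwich_bijective.1 (LinearMap.ext h)
  have hnondeg (x : A) (h : ∀ c, t (x * c) = 0) : x = 0 := by
    by_contra hx
    let I : TwoSidedIdeal A := TwoSidedIdeal.mk' {x | ∀ c, t (x * c) = 0} (by simp)
      (fun {x y} hx hy c ↦ by simp [add_mul, hx c, hy c]) (fun {x} hx c ↦ by simp [hx c])
      (fun {x y} hy c ↦ by rw [mul_assoc, hcomm, mul_assoc]; exact hy _)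
      (fun {x y} hx c ↦ by rw [mul_assoc]; exact hx _)
    have := IsSimpleRing.one_mem_of_ne_zero_mem I (x := x) hx (by
      rw [TwoSidedIdeal.mem_mk']
      exact h)
    rw [TwoSidedIdeal.mem_mk'] at this
    exact ha₀ (by simpa using this a₀)
  have hgz (z) : g * z = Algebra.TensorProduct.comm F A A z * g := by
    induction z with
    | zero => simp
    | add x y hx hy => simp [mul_add, add_mul, hx, hy]
    | tmul a b =>
      refine ext fun c ↦ ?_
      rw [Algebra.TensorProduct.comm_tmul, sandwich_mul_tmul, sandwich_tmul_mul, hg', hg', hcomm,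
        Algebra.commutes]
  have hσ : Algebra.TensorProduct.comm F A A g = g := by
    refine ext fun c ↦ ?_
    have key (z : A ⊗[F] A) (d) : t (sandwich F A (Algebra.TensorProduct.comm F A A z) c * d) =
        t (sandwich F A z d * c) := by
      induction z with
      | zero => simp
      | add x y hx hy => simp [add_mul, hx, hy]
      | tmul x y =>
        simp only [Algebra.TensorProduct.comm_tmul, sandwich_tmul]
        rw [mul_assoc, hcomm]
        simp only [mul_assoc]
    rw [← sub_eq_zero]
    refine hnondeg _ fun d ↦ ?_
    rw [sub_mul, map_sub, key, hg', hg', ← Algebra.smul_def, ← Algebra.smul_def, map_smul,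
      map_smul, smul_eq_mul, smul_eq_mul, mul_comm, sub_self]
  obtain ⟨r, hr⟩ : ∃ r : F, g * g = algebraMap F _ r := by
    have := isCentral_tensorProduct (F := F) (A := A) (B := A)
    have : g * g ∈ Subalgebra.center F (A ⊗[F] A) := by
      rw [Subalgebra.mem_center_iff]
      intro z
      have : Algebra.TensorProduct.comm F A A (Algebra.TensorProduct.comm F A A z) = z :=
        (Algebra.TensorProduct.comm F A A).apply_symm_apply z
      rw [mul_assoc g g z, hgz z, ← mul_assoc g, hgz (Algebra.TensorProduct.comm F A A z), this, mul_assoc]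
    obtain ⟨r, hr⟩ := (Algebra.IsCentral.mem_center_iff F).1 this
    exact ⟨r, hr⟩
  let T : A ⊗[F] A →ₗ[F] F := TensorProduct.lift (LinearMap.mul F F |>.compl₁₂ t t)
  have hT (a b) : T (a ⊗ₜ b) = t a * t b := rfl
  have hT_symm (w : A ⊗[F] A) (hw : TensorProduct.comm F A A w = w) :
      T w = t (LinearMap.mul' F A w) := by
    obtain ⟨c, y, hcy⟩ := TensorProduct.exists_eq_sum_add_of_comm_eq (Module.finBasis F A) w hw
    have h1 (y : A ⊗[F] A) : T (y + TensorProduct.comm F A A y) = 0 := by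
      induction y with
      | zero => simp
      | add x y hx hy => rw [map_add (TensorProduct.comm F A A), add_add_add_comm, map_add T, hx, hy, add_zero]
      | tmul x y =>
        rw [TensorProduct.comm_tmul, map_add, hT, hT, mul_comm, CharTwo.add_self_eq_zero]
    have h2 (y : A ⊗[F] A) : t (LinearMap.mul' F A (y + TensorProduct.comm F A A y)) = 0 := by
      induction y with
      | zero => simp
      | add x y hx hy => rw [map_add (TensorProduct.comm F A A), add_add_add_comm, map_add (LinearMap.mul' F A),
          map_add t, hx, hy, add_zero]
      | tmul x y =>
        rw [TensorProduct.comm_tmul, map_add, LinearMap.mul'_apply, LinearMap.mul'_apply, map_add,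
          hcomm, CharTwo.add_self_eq_zero]
    rw [hcy, map_add T, map_add (LinearMap.mul' F A), map_add t, h1, h2]
    simp [hT, hsq, sq]
  have hr1 : r * t (a₀ * a₀) = t a₀ ^ 2 := by
    have e1 (z : A ⊗[F] A) : t (sandwich F A (g * z) a₀ * a₀) = T (z * a₀ ⊗ₜ a₀) := by
      induction z with
      | zero => simp
      | add x y hx hy => simp [mul_add, add_mul, hx, hy]
      | tmul x y =>
        rw [sandwich_mul_tmul, hg', Algebra.TensorProduct.tmul_mul_tmul, hT, mul_assoc,
          ← Algebra.smul_def, map_smul, hcomm x, smul_eq_mul]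
    have e2 (z : A ⊗[F] A) : LinearMap.mul' F A (z * a₀ ⊗ₜ a₀) = sandwich F A z a₀ * a₀ := by
      induction z with
      | zero => simp
      | add x y hx hy => simp [add_mul, hx, hy]
      | tmul x y => simp [mul_assoc]
    have e3 : TensorProduct.comm F A A (g * a₀ ⊗ₜ a₀) = g * a₀ ⊗ₜ a₀ := by
      change Algebra.TensorProduct.comm F A A (g * a₀ ⊗ₜ a₀) = _
      rw [map_mul, hσ, Algebra.TensorProduct.comm_tmul]
    have := e1 g
    rw [hT_symm _ e3, e2, hg', hr, Algebra.algebraMap_eq_smul_one, map_smul,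
      Algebra.TensorProduct.one_def, LinearMap.smul_apply, sandwich_tmul, one_mul, mul_one,
      smul_mul_assoc, map_smul, ← Algebra.smul_def, map_smul] at this
    rw [sq]
    exact this
  have : r = 1 := by
    rw [hsq] at hr1
    exact mul_right_cancel₀ (pow_ne_zero 2 ha₀) (hr1.trans (one_mul _).symm)
  exact ⟨g, by rw [hr, this, map_one], hgz, hσ⟩

end Goldman

section Homology

variable {F V : Type*} [Field F] [AddCommGroup V] [Module F V] [FiniteDimensional F V]

/-- The homology of a square-zero endomorphism as a subquotient with chosen coordinates. -/
theorem Module.End.exists_homology (ν : Module.End F V) (hν : ν * ν = 0) :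
    ∃ (h : ℕ) (i : (Fin h → F) →ₗ[F] V) (p : V →ₗ[F] (Fin h → F)),
      ν ∘ₗ i = 0 ∧ p ∘ₗ ν = 0 ∧ p ∘ₗ i = .id ∧ ∀ v, ν v = 0 → ∃ w, v = i (p v) + ν w := by
  let K := LinearMap.ker ν
  let R : Submodule F K := (LinearMap.range ν).comap K.subtype
  let e := (Module.finBasis F (K ⧸ R)).equivFun
  obtain ⟨s, hs⟩ := LinearMap.exists_rightInverse_of_surjective R.mkQ R.range_mkQ
  obtain ⟨p, hp⟩ := LinearMap.exists_extend (p := K) (e.toLinearMap ∘ₗ R.mkQ)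
  have hp' (v : K) : p v = e (R.mkQ v) := LinearMap.congr_fun hp v
  have hs' (v) : R.mkQ (s v) = v := LinearMap.congr_fun hs v
  refine ⟨_, K.subtype ∘ₗ s ∘ₗ e.symm.toLinearMap, p, ?_, ?_, ?_, fun v hv ↦ ?_⟩
  · ext1 v
    ext
    exact (s (e.symm _)).2
  · ext v : 1
    have hv : ν v ∈ K := LinearMap.congr_fun hν v
    have := hp' ⟨ν v, hv⟩
    rw [Submodule.mkQ_apply, (Submodule.Quotient.mk_eq_zero R (x := ⟨ν v, hv⟩)).2 ⟨v, rfl⟩,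
      map_zero] at this
    exact this
  · refine LinearMap.ext fun v ↦ ?_
    change p (s (e.symm v) : K) = v
    rw [hp', hs', e.apply_symm_apply]
  · have hpv := hp' ⟨v, hv⟩
    have h0 : (⟨v, hv⟩ : K) - s (e.symm (p v)) ∈ R := by
      rw [← Submodule.Quotient.mk_eq_zero]
      change R.mkQ _ = 0
      rw [map_sub, hs', hpv, e.symm_apply_apply, sub_self]
    obtain ⟨w, hw⟩ := h0
    refine ⟨w, ?_⟩
    rw [hw]
    simp

end Homology

/-- The field `F` seen as an `F`-algebra through the Frobenius, that is, `F^{1/2}`. -/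
def FrobRoot (F : Type) : Type := F

noncomputable instance (F : Type) [Field F] : Field (FrobRoot F) := inferInstanceAs (Field F)

noncomputable instance (F : Type) [Field F] [CharP F 2] : Algebra F (FrobRoot F) :=
  (frobenius F 2).toAlgebra

theorem finrank_eq_of_forall_exists_sum {F A E : Type*} [Field F] [Ring A] [Algebra F A]
    [FiniteDimensional F A] [IsSimpleRing A] [Algebra.IsCentral F A] [Field E] [Algebra F E]
    {h : ℕ} [Nonempty (Fin h)] (f : A →ₐ[F] Matrix (Fin h) (Fin h) E)
    (hf : ∀ M, ∃ (n : ℕ) (c : Fin n → E) (a : Fin n → A), M = ∑ j, c j • f (a j)) :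
    Module.finrank F A = h * h := by
  have := isSimpleRing_baseChange (F := F) (A := A) E
  let g : E ⊗[F] A →ₐ[E] Matrix (Fin h) (Fin h) E := Algebra.TensorProduct.lift
    (Algebra.ofId E (Matrix (Fin h) (Fin h) E)) f fun _ _ ↦ Algebra.commutes _ _
  have hg : Function.Surjective g := by
    intro M
    obtain ⟨n, c, a, rfl⟩ := hf M
    refine ⟨∑ j, c j ⊗ₜ a j, ?_⟩
    rw [map_sum]
    refine Finset.sum_congr rfl fun j _ ↦ ?_
    exact (Algebra.TensorProduct.lift_tmul ..).trans (Algebra.smul_def (c j) (f (a j))).symm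
  have := (LinearEquiv.ofBijective g.toLinearMap ⟨g.toRingHom.injective, hg⟩).finrank_eq
  rw [Module.finrank_baseChange, Module.finrank_matrix, Module.finrank_self] at this
  simpa using this

section FrobeniusSplitting

variable {F A V : Type} [Field F] [CharP F 2] [Ring A] [Algebra F A]
  [FiniteDimensional F A] [IsSimpleRing A] [Algebra.IsCentral F A]
  [AddCommGroup V] [Module F V] [FiniteDimensional F V]

theorem exists_algHom_frobRoot (Ψ : A ⊗[F] A ≃ₐ[F] Module.End F V) :
    ∃ (h : ℕ) (_ : A →ₐ[F] Matrix (Fin h) (Fin h) (FrobRoot F)), Module.finrank F A = h * h := by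
  have : CharP (A ⊗[F] A) 2 := charP_of_injective_algebraMap' F 2
  have : CharP (Module.End F V) 2 := by
    have := Ψ.injective.nontrivial
    exact charP_of_injective_algebraMap (algebraMap F (Module.End F V)).injective 2
  obtain ⟨g, hgg, hgz, hσg⟩ := exists_goldman (F := F) (A := A)
  let σ := Algebra.TensorProduct.comm F A A
  let ν : Module.End F V := 1 + Ψ g
  have hγ2 : Ψ g * Ψ g = 1 := by rw [← map_mul, hgg, map_one]
  have hν : ν * ν = 0 := by
    simp only [ν, add_mul, mul_add, one_mul, mul_one, hγ2]
    rw [add_comm (Ψ g), CharTwo.add_self_eq_zero]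
  have hγ (v) : Ψ g v = v + ν v := by
    have : Ψ g = 1 + ν := by rw [← add_assoc, CharTwo.add_self_eq_zero, zero_add]
    conv_lhs => rw [this]
    rfl
  obtain ⟨h, i, p, hνi, hpν, hpi, hker⟩ := Module.End.exists_homology ν hν
  replace hνi (w) : ν (i w) = 0 := LinearMap.congr_fun hνi w
  replace hpν (v) : p (ν v) = 0 := LinearMap.congr_fun hpν v
  replace hpi (w) : p (i w) = w := LinearMap.congr_fun hpi w
  let T : A ⊗[F] A →ₗ[F] Module.End F (Fin h → F) :=
    { toFun := fun z ↦ p ∘ₗ Ψ z ∘ₗ i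
      map_add' := fun x y ↦ by ext; simp
      map_smul' := fun c x ↦ by ext; simp }
  have hT (z w) : T z w = p (Ψ z (i w)) := rfl
  have hcomm {z : A ⊗[F] A} (hz : σ z = z) (v) : Ψ z (ν v) = ν (Ψ z v) := by
    have : Ψ z * Ψ g = Ψ g * Ψ z := by
      rw [← map_mul, ← map_mul, hgz]
      exact congrArg (fun x ↦ Ψ (x * g)) hz.symm
    have h1 : Ψ z * ν = ν * Ψ z := by
      simp only [ν, add_mul, mul_add, one_mul, mul_one, this]
    exact LinearMap.congr_fun h1 v
  have hT_mul {x y : A ⊗[F] A} (hx : σ x = x) (hy : σ y = y) : T (x * y) = T x * T y := by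
    refine LinearMap.ext fun w ↦ ?_
    rw [Module.End.mul_apply, hT, hT, hT, map_mul, Module.End.mul_apply]
    obtain ⟨v, hv⟩ := hker (Ψ y (i w)) (by rw [← hcomm hy, hνi, map_zero])
    conv_lhs => rw [hv]
    rw [map_add, map_add, hcomm hx, hpν, add_zero]
  have hT_one : T 1 = 1 := by
    refine LinearMap.ext fun w ↦ ?_
    rw [hT, map_one]
    exact hpi w
  have hT_trace (y : A ⊗[F] A) : T (y + σ y) = 0 := by
    have : σ y = g * y * g := by rw [hgz, mul_assoc, hgg, mul_one]
    refine LinearMap.ext fun w ↦ ?_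
    rw [hT, this, map_add, map_mul, map_mul, LinearMap.add_apply, Module.End.mul_apply,
      Module.End.mul_apply, hγ (i w), hνi, add_zero, hγ, ← add_assoc, ← two_smul F,
      CharTwo.two_eq_zero, zero_smul, zero_add, hpν]
    rfl
  have hσ (a : A) : σ (a ⊗ₜ a) = a ⊗ₜ a := Algebra.TensorProduct.comm_tmul ..
  let ρ : A →+* Matrix (Fin h) (Fin h) F := (LinearMap.toMatrixAlgEquiv' (R := F)).toRingEquiv.toRingHom.comp
    { toFun := fun a ↦ T (a ⊗ₜ a)
      map_one' := hT_one
      map_mul' := fun a b ↦ by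
        rw [← Algebra.TensorProduct.tmul_mul_tmul, hT_mul (hσ a) (hσ b)]
      map_zero' := by simp
      map_add' := fun a b ↦ by
        have : (a + b) ⊗ₜ[F] (a + b) = a ⊗ₜ a + b ⊗ₜ b + (a ⊗ₜ b + σ (a ⊗ₜ b)) := by
          rw [show σ (a ⊗ₜ b) = b ⊗ₜ a from Algebra.TensorProduct.comm_tmul ..]
          simp only [TensorProduct.add_tmul, TensorProduct.tmul_add]
          abel
        rw [this, map_add T, hT_trace, add_zero, map_add] }
  have hρ (a) : ρ a = LinearMap.toMatrixAlgEquiv' (T (a ⊗ₜ a)) := rfl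
  let f : A →ₐ[F] Matrix (Fin h) (Fin h) (FrobRoot F) :=
    { (ρ : A →+* Matrix (Fin h) (Fin h) F) with
      commutes' := fun c ↦ by
        change ρ (algebraMap F A c) = _
        rw [hρ, Algebra.algebraMap_eq_smul_one, TensorProduct.smul_tmul_smul, map_smul,
          ← Algebra.TensorProduct.one_def, hT_one, map_smul, map_one]
        ext j k
        rw [Matrix.algebraMap_matrix_apply, Matrix.smul_apply, Matrix.one_apply]
        split_ifs
        · rw [smul_eq_mul, mul_one]
          exact (sq c).symm
        · exact smul_zero _ }
  have hf (a) : f a = LinearMap.toMatrixAlgEquiv' (T (a ⊗ₜ a)) := rfl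
  refine ⟨h, f, ?_⟩
  have hpos : Nonempty (Fin h) := by
    by_contra hempty
    rw [not_nonempty_iff] at hempty
    have hker' (v) (hv : ν v = 0) : ∃ w, v = ν w := by
      obtain ⟨w, hw⟩ := hker v hv
      rw [Subsingleton.elim (p v) 0, map_zero, zero_add] at hw
      exact ⟨w, hw⟩
    obtain ⟨s, hs⟩ := LinearMap.exists_rightInverse_of_surjective ν.rangeRestrict
      ν.range_rangeRestrict
    obtain ⟨s', hs'⟩ := LinearMap.exists_extend (p := LinearMap.range ν) s
    have hs'' (v) : ν (s' (ν v)) = ν v := by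
      have h1 : s' (ν v) = s ⟨ν v, v, rfl⟩ := LinearMap.congr_fun hs' ⟨ν v, v, rfl⟩
      have h2 := LinearMap.congr_fun hs ⟨ν v, v, rfl⟩
      rw [h1]
      exact congrArg Subtype.val h2
    have hX : (s' * (1 - s' * ν)) * ν + ν * (s' * (1 - s' * ν)) = 1 := by
      refine LinearMap.ext fun v ↦ ?_
      have h1 : (s' * (1 - s' * ν)) * ν = s' * ν := by
        rw [mul_assoc, sub_mul, mul_assoc, hν, mul_zero, sub_zero, one_mul]
      rw [h1]
      obtain ⟨w, hw⟩ := hker' (v - s' (ν v)) (by rw [map_sub, hs'', sub_self])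
      change s' (ν v) + ν (s' (v - s' (ν v))) = v
      rw [hw, hs'', ← hw, add_sub_cancel]
    obtain ⟨x, hx⟩ := Ψ.surjective (s' * (1 - s' * ν))
    have hxg : x * g + g * x = 1 := by
      apply Ψ.injective
      rw [map_one, ← hX, map_add, map_mul, map_mul, hx]
      simp only [ν, mul_add, add_mul, one_mul, mul_one]
      set S := s' * (1 - s' * ν)
      rw [add_add_add_comm, CharTwo.add_self_eq_zero, zero_add]
    have hy : x * g + σ (x * g) = 1 := by
      rw [map_mul, show σ g = g from hσg, ← hgz, hxg]
    obtain ⟨φ, hφ⟩ := Module.Projective.exists_dual_eq_one F (one_ne_zero (α := A))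
    let Φ : A ⊗[F] A →ₗ[F] F := TensorProduct.lift (LinearMap.mul F F |>.compl₁₂ φ φ)
    have hΦ (a b) : Φ (a ⊗ₜ b) = φ a * φ b := rfl
    have hΦσ (z) : Φ (σ z) = Φ z := by
      induction z with
      | zero => simp
      | add x y hx hy => rw [map_add σ, map_add, map_add, hx, hy]
      | tmul x y =>
        rw [show σ (x ⊗ₜ y) = y ⊗ₜ x from Algebra.TensorProduct.comm_tmul .., hΦ, hΦ, mul_comm]
    have h1 := congrArg Φ hy
    rw [map_add, hΦσ, CharTwo.add_self_eq_zero, Algebra.TensorProduct.one_def, hΦ, hφ,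
      mul_one] at h1
    exact zero_ne_one h1
  refine finrank_eq_of_forall_exists_sum f fun M ↦ ?_
  obtain ⟨φ, rfl⟩ := (LinearMap.toMatrixAlgEquiv' (R := F)).surjective M
  obtain ⟨w, hw⟩ := Ψ.surjective (i ∘ₗ φ ∘ₗ p)
  have hTw : T w = φ := by
    refine LinearMap.ext fun v ↦ ?_
    rw [hT, hw]
    simp [hpi]
  have hσw : σ w = w := by
    have h1 : Ψ (g * w) = Ψ (w * g) := by
      refine LinearMap.ext fun v ↦ ?_
      rw [map_mul, map_mul, Module.End.mul_apply, Module.End.mul_apply, hγ, hγ, hw]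
      simp [hνi, hpν]
    rw [← mul_one (σ w), ← hgg, ← mul_assoc, ← hgz, Ψ.injective h1, mul_assoc, hgg, mul_one]
  obtain ⟨c, y, hcy⟩ := TensorProduct.exists_eq_sum_add_of_comm_eq (Module.finBasis F A) w hσw
  have hφ : φ = ∑ j, c j • T (Module.finBasis F A j ⊗ₜ Module.finBasis F A j) := by
    rw [← hTw, hcy, map_add, map_sum]
    simp only [map_smul]
    exact add_eq_left.2 (hT_trace y)
  let c' : Fin (Module.finrank F A) → FrobRoot F := c
  refine ⟨_, c', Module.finBasis F A, ?_⟩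
  rw [hφ, map_sum]
  exact Finset.sum_congr rfl fun j _ ↦ map_smul LinearMap.toMatrixAlgEquiv' (c j) _

end FrobeniusSplitting

section QuadraticDescent

/-- The idempotent derivation attached to a purely inseparable quadratic extension. -/
theorem exists_derivation_of_sq_mem {M N : Type*} [Field M] [Field N] [Algebra M N] [CharP N 2]
    {s : N} (hs2 : s ^ 2 ∈ Set.range (algebraMap M N)) (hs : s ∉ Set.range (algebraMap M N))
    (hN : ∀ c : N, ∃ p q : M, c = algebraMap M N p + algebraMap M N q * s) :
    ∃ d : N →ₗ[M] N, (∀ x y, d (x * y) = d x * y + x * d y) ∧ (∀ x, d (d x) = d x) ∧ d s = s := by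
  obtain ⟨b, hb⟩ := hs2
  choose p q hpq using hN
  have huniq {c : N} {x y : M} (h : c = algebraMap M N x + algebraMap M N y * s) : q c = y := by
    by_contra hne
    apply hs
    refine ⟨(x - p c) / (q c - y), ?_⟩
    have h0 : algebraMap M N (q c - y) ≠ 0 := by simpa [sub_eq_zero] using hne
    rw [map_div₀, div_eq_iff h0, map_sub, map_sub]
    linear_combination hpq c - h
  let d : N →ₗ[M] N :=
    { toFun := fun c ↦ algebraMap M N (q c) * s
      map_add' := fun x y ↦ by
        have : q (x + y) = q x + q y := huniq (x := p x + p y) (by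
          rw [map_add, map_add]
          linear_combination hpq x + hpq y)
        rw [this, map_add, add_mul]
      map_smul' := fun m x ↦ by
        have : q (m • x) = m * q x := huniq (x := m * p x) (by
          rw [map_mul, map_mul, Algebra.smul_def]
          linear_combination algebraMap M N m * hpq x)
        rw [this, map_mul, Algebra.smul_def, mul_assoc]
        rfl }
  have hd (c) : d c = algebraMap M N (q c) * s := rfl
  refine ⟨d, fun x y ↦ ?_, fun x ↦ ?_, ?_⟩
  · have : q (x * y) = p x * q y + q x * p y := huniq (x := p x * p y + b * q x * q y) (by
      simp only [map_add, map_mul, hb]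
      linear_combination x * hpq y + (algebraMap M N (p y) + algebraMap M N (q y) * s) * hpq x)
    rw [hd, hd, hd, this]
    simp only [map_add, map_mul]
    have h2 : (2 : N) = 0 := CharTwo.two_eq_zero
    linear_combination (-algebraMap M N (q x) * s) * hpq y - (algebraMap M N (q y) * s) * hpq x
      - algebraMap M N (q x) * algebraMap M N (q y) * s ^ 2 * h2
  · have : q (d x) = q x := huniq (x := 0) (by rw [map_zero, zero_add, hd])
    rw [hd, this, hd]
  · have : q s = 1 := huniq (x := 0) (by simp)
    rw [hd, this, map_one, one_mul]

variable {F M N A : Type} [Field F] [Field M] [Field N] [Algebra F M] [Algebra M N]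
  [Algebra F N] [IsScalarTower F M N] [Ring A] [Algebra F A] [FiniteDimensional F A]
  [IsSimpleRing A] [Algebra.IsCentral F A]

/-- A splitting of `A` over `N`, as an isomorphism. -/
theorem exists_algEquiv_of_algHom {n : ℕ} [NeZero n] (f : A →ₐ[F] Matrix (Fin n) (Fin n) N)
    (hf : Module.finrank F A = n * n) :
    ∃ Θ : N ⊗[F] A ≃ₐ[N] Matrix (Fin n) (Fin n) N, ∀ c a, Θ (c ⊗ₜ a) = c • f a := by
  have := isSimpleRing_baseChange (F := F) (A := A) N
  let g : N ⊗[F] A →ₐ[N] Matrix (Fin n) (Fin n) N := Algebra.TensorProduct.lift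
    (Algebra.ofId N (Matrix (Fin n) (Fin n) N)) f fun _ _ ↦ Algebra.commutes _ _
  have hg := g.bijective_of_finrank_eq (by
    rw [Module.finrank_baseChange, Module.finrank_matrix, Module.finrank_self, hf]
    simp)
  refine ⟨AlgEquiv.ofBijective g hg, fun c a ↦ ?_⟩
  rw [Algebra.smul_def]
  exact Algebra.TensorProduct.lift_tmul (Algebra.ofId N _) f (fun _ _ ↦ Algebra.commutes _ _) c a

theorem exists_connection {n : ℕ} [NeZero n] (f : A →ₐ[F] Matrix (Fin n) (Fin n) N)
    (hf : Module.finrank F A = n * n) (d : N →ₗ[M] N)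
    (hd : ∀ x y, d (x * y) = d x * y + x * d y) :
    ∃ x : (Fin n → N) →ₗ[M] (Fin n → N), (∀ a v, x ((f a).mulVec v) = (f a).mulVec (x v)) ∧
      ∀ (c : N) v, x (c • v) = d c • v + c • x v := by
  obtain ⟨Θ, hΘ⟩ := exists_algEquiv_of_algHom f hf
  let D₀ : N ⊗[F] A →ₗ[F] N ⊗[F] A := (d.restrictScalars F).rTensor A
  have hD₀_smul (c : N) (z) : D₀ (c • z) = d c • z + c • D₀ z := by
    induction z with
    | zero => simp
    | add x y hx hy =>
      rw [smul_add, map_add, hx, hy, map_add, smul_add, smul_add]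
      abel
    | tmul x y => simp [D₀, TensorProduct.smul_tmul', hd, TensorProduct.add_tmul]
  have hD₀_mul (a : A) (z) : D₀ (1 ⊗ₜ a * z) = 1 ⊗ₜ a * D₀ z := by
    induction z with
    | zero => simp
    | add x y hx hy => rw [mul_add, map_add, hx, hy, map_add, mul_add]
    | tmul x y => simp [D₀]
  let D : Matrix (Fin n) (Fin n) N → Matrix (Fin n) (Fin n) N := fun r ↦ Θ (D₀ (Θ.symm r))
  have hD_add (r r') : D (r + r') = D r + D r' := by simp [D]
  have hD_smul (c : N) (r) : D (c • r) = d c • r + c • D r := by simp [D, hD₀_smul]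
  have hD_mul (a : A) (r) : D (f a * r) = f a * D r := by
    have : f a = Θ (1 ⊗ₜ a) := by rw [hΘ, one_smul]
    simp only [D, this, map_mul, Θ.symm_apply_apply, hD₀_mul]
  let e : Fin n → N := Pi.single 0 1
  let u : (Fin n → N) →ₗ[N] Matrix (Fin n) (Fin n) N :=
    { toFun := fun v ↦ Matrix.vecMulVec v e
      map_add' := fun v w ↦ Matrix.add_vecMulVec ..
      map_smul' := fun c v ↦ Matrix.smul_vecMulVec .. }
  have hu (v) : u v = Matrix.vecMulVec v e := rfl
  have hue (v) : (u v).mulVec e = v := by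
    rw [hu, Matrix.vecMulVec_mulVec]
    simp [e]
  have hd1 (m : M) : d (algebraMap M N m) = 0 := by
    have h1 : d 1 = 0 := by simpa using hd 1 1
    rw [Algebra.algebraMap_eq_smul_one, map_smul, h1, smul_zero]
  have hx (c : N) (v) : (D (u (c • v))).mulVec e = d c • v + c • (D (u v)).mulVec e := by
    rw [map_smul, hD_smul, Matrix.add_mulVec, Matrix.smul_mulVec, Matrix.smul_mulVec, hue]
  refine ⟨{ toFun := fun v ↦ (D (u v)).mulVec e
            map_add' := fun v w ↦ by rw [map_add, hD_add, Matrix.add_mulVec]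
            map_smul' := fun m v ↦ ?_ }, fun a v ↦ ?_, hx⟩
  · rw [← algebraMap_smul N m v, hx, hd1, zero_smul, zero_add, algebraMap_smul]
    rfl
  · change (D (u ((f a).mulVec v))).mulVec e = (f a).mulVec ((D (u v)).mulVec e)
    rw [hu, ← Matrix.mul_vecMulVec, hD_mul, Matrix.mulVec_mulVec, hu]

theorem exists_scalar_of_commute {n : ℕ} [NeZero n] (f : A →ₐ[F] Matrix (Fin n) (Fin n) N)
    (hf : Module.finrank F A = n * n) (φ : (Fin n → N) →ₗ[N] (Fin n → N))
    (hφ : ∀ a v, φ ((f a).mulVec v) = (f a).mulVec (φ v)) : ∃ c : N, ∀ v, φ v = c • v := by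
  obtain ⟨Θ, hΘ⟩ := exists_algEquiv_of_algHom f hf
  have hcomm (z) : LinearMap.toMatrix' φ * Θ z = Θ z * LinearMap.toMatrix' φ := by
    induction z with
    | zero => simp
    | add x y hx hy => rw [map_add, mul_add, add_mul, hx, hy]
    | tmul x y =>
      rw [hΘ, mul_smul_comm, smul_mul_assoc]
      congr 1
      apply Matrix.toLin'.injective
      refine LinearMap.ext fun v ↦ ?_
      simp only [Matrix.toLin'_mul, Matrix.toLin'_toMatrix', LinearMap.comp_apply,
        Matrix.toLin'_apply, hφ]
  have hmem : LinearMap.toMatrix' φ ∈ Subalgebra.center N (Matrix (Fin n) (Fin n) N) := by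
    rw [Subalgebra.mem_center_iff]
    intro r
    obtain ⟨z, rfl⟩ := Θ.surjective r
    exact (hcomm z).symm
  obtain ⟨c, hc⟩ := (Algebra.IsCentral.mem_center_iff N).1 hmem
  refine ⟨c, fun v ↦ ?_⟩
  rw [← LinearMap.toMatrix'_mulVec φ v, hc, Algebra.algebraMap_eq_smul_one, Matrix.smul_mulVec,
    Matrix.one_mulVec]

variable [CharP F 2]

theorem exists_algHom_tensor_symbolAlg {n : ℕ} [NeZero n]
    (f : A →ₐ[F] Matrix (Fin n) (Fin n) N) (hf : Module.finrank F A = n * n)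
    {s : N} {b : F} (hb : s ^ 2 = algebraMap F N b) (hs : s ∉ Set.range (algebraMap M N))
    (hN : ∀ c : N, ∃ p q : M, c = algebraMap M N p + algebraMap M N q * s)
    (hsq : ∀ c : N, c ^ 2 ∈ Set.range (algebraMap F N)) :
    ∃ α : F, Nonempty (A ⊗[F] SymbolAlg F 2 α b →ₐ[F] Module.End M (Fin n → N)) := by
  have : CharP N 2 := charP_of_injective_algebraMap' F 2
  have : CharP (Module.End M (Fin n → N)) 2 :=
    charP_of_injective_algebraMap' F 2
  obtain ⟨d, hd, hdd, hds⟩ := exists_derivation_of_sq_mem (M := M)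
    ⟨algebraMap F M b, by rw [hb, ← IsScalarTower.algebraMap_apply]⟩ hs hN
  obtain ⟨x, hxf, hx⟩ := exists_connection f hf d hd
  have h2 : (2 : N) = 0 := CharTwo.two_eq_zero
  have two (v : Fin n → N) : v + v = 0 := by rw [← two_smul N, CharTwo.two_eq_zero, zero_smul]
  obtain ⟨a, ha⟩ := exists_scalar_of_commute f hf
    { toFun := fun v ↦ x (x v) + x v
      map_add' := fun v w ↦ by simp only [map_add]; abel
      map_smul' := fun c v ↦ by
        simp only [hx, map_add, hdd, RingHom.id_apply, smul_add]
        rw [show d c • v + d c • x v + (d c • x v + c • x (x v)) + (d c • v + c • x v) =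
          (d c • v + d c • v) + (d c • x v + d c • x v) + (c • x (x v) + c • x v) by abel,
          two, two, zero_add, zero_add] }
    (fun a v ↦ by simp only [LinearMap.coe_mk, AddHom.coe_mk, hxf, Matrix.mulVec_add])
  replace ha (v) : x (x v) + x v = a • v := ha v
  have hda : d a = 0 := by
    have h1 := ha (x 1)
    rw [← map_add, ha, hx, add_eq_right] at h1
    simpa using congrFun h1 0
  obtain ⟨α, hα⟩ := hsq a
  let mul (c : N) : Module.End M (Fin n → N) := LinearMap.lsmul N (Fin n → N) c |>.restrictScalars M
  have hmul (c v) : mul c v = c • v := rfl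
  refine ⟨α, ⟨Algebra.TensorProduct.lift
    { toFun := fun r ↦ (Matrix.mulVecLin (f r)).restrictScalars M
      map_one' := LinearMap.ext fun v ↦ by simp
      map_mul' := fun r t ↦ LinearMap.ext fun v ↦ by simp
      map_zero' := LinearMap.ext fun v ↦ by simp
      map_add' := fun r t ↦ LinearMap.ext fun v ↦ by simp
      commutes' := fun c ↦ by
        refine LinearMap.ext fun v ↦ ?_
        simp [Algebra.algebraMap_eq_smul_one] }
    (SymbolAlg.lift (x + mul a) (mul s) ?_ ?_ ?_) fun r q ↦ ?_⟩⟩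
  · refine LinearMap.ext fun v ↦ ?_
    rw [Module.algebraMap_end_apply, ← algebraMap_smul N α v, hα, sq, LinearMap.sub_apply,
      Module.End.mul_apply]
    simp only [LinearMap.add_apply, hmul, map_add, hx, hda, zero_smul, zero_add]
    ext i
    have hi := congrFun (ha v) i
    simp only [Pi.add_apply, Pi.sub_apply, Pi.smul_apply, smul_eq_mul] at hi ⊢
    linear_combination hi + (a * x v i - x v i) * h2
  · refine LinearMap.ext fun v ↦ ?_
    rw [Module.algebraMap_end_apply, ← algebraMap_smul N b v, ← hb, sq, sq, Module.End.mul_apply,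
      hmul, hmul, smul_smul]
  · refine LinearMap.ext fun v ↦ ?_
    rw [LinearMap.sub_apply, Module.End.mul_apply, Module.End.mul_apply]
    simp only [LinearMap.add_apply, hmul, hx, hds, smul_add]
    ext i
    simp only [Pi.add_apply, Pi.sub_apply, Pi.smul_apply, smul_eq_mul]
    linear_combination -(s * v i) * h2
  · refine (SymbolAlg.commute_of_generators _ _ ?_ ?_ q).symm
    · rw [SymbolAlg.lift_X]
      refine LinearMap.ext fun v ↦ ?_
      simp [hxf, hmul, Matrix.mulVec_add, Matrix.mulVec_smul]
    · rw [SymbolAlg.lift_Y]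
      refine LinearMap.ext fun v ↦ ?_
      simp [hmul]

end QuadraticDescent

section AlbertDescent

theorem finrank_eq_two_of_forall_exists {M N : Type*} [Field M] [Field N] [Algebra M N]
    {s : N} (hs : s ∉ Set.range (algebraMap M N))
    (hN : ∀ c : N, ∃ p q : M, c = algebraMap M N p + algebraMap M N q * s) :
    Module.finrank M N = 2 := by
  have hli : LinearIndependent M ![(1 : N), s] := by
    rw [LinearIndependent.pair_iff' one_ne_zero]
    intro a ha
    exact hs ⟨a, by rw [← ha, Algebra.smul_def, mul_one]⟩
  have hsp : ⊤ ≤ Submodule.span M (Set.range ![(1 : N), s]) := by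
    rintro c -
    obtain ⟨p, q, rfl⟩ := hN c
    rw [Matrix.range_cons, Matrix.range_cons, Matrix.range_empty, Set.union_empty,
      Set.singleton_union, Submodule.mem_span_pair]
    exact ⟨p, q, by simp [Algebra.smul_def]⟩
  simpa using Module.finrank_eq_card_basis (Module.Basis.mk hli hsp)

attribute [local instance] isCentral_tensorProduct isSimpleRing_tensorProduct

variable {F : Type} [Field F] [CharP F 2]

theorem exists_algHom_tensor_symbolAlg_matrix {M N A : Type} [Field M] [Field N] [Algebra F M]
    [Algebra M N] [Algebra F N] [IsScalarTower F M N] [Ring A] [Algebra F A]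
    [FiniteDimensional F A] [IsSimpleRing A] [Algebra.IsCentral F A] {n : ℕ} [NeZero n]
    (f : A →ₐ[F] Matrix (Fin n) (Fin n) N) (hf : Module.finrank F A = n * n)
    {s : N} {b : F} (hb : s ^ 2 = algebraMap F N b) (hs : s ∉ Set.range (algebraMap M N))
    (hN : ∀ c : N, ∃ p q : M, c = algebraMap M N p + algebraMap M N q * s)
    (hsq : ∀ c : N, c ^ 2 ∈ Set.range (algebraMap F N)) :
    ∃ α : F, Nonempty (A ⊗[F] SymbolAlg F 2 α b →ₐ[F] Matrix (Fin (n * 2)) (Fin (n * 2)) M) := by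
  obtain ⟨α, ⟨g⟩⟩ := exists_algHom_tensor_symbolAlg f hf hb hs hN hsq
  have hrank := finrank_eq_two_of_forall_exists hs hN
  have : FiniteDimensional M N := .of_finrank_pos (by lia)
  let bas := Module.finBasisOfFinrankEq (n := n * 2) M (Fin n → N) (by
    rw [Module.finrank_pi_fintype]
    simp [hrank])
  exact ⟨α, ⟨((LinearMap.toMatrixAlgEquiv bas).restrictScalars F).toAlgHom.comp g⟩⟩

theorem isSymbolProduct_brauerClass_of_tensor {A : Type} [Ring A] [Algebra F A]
    [FiniteDimensional F A] [IsSimpleRing A] [Algebra.IsCentral F A] {α : F} {b : Fˣ}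
    [IsSimpleRing (SymbolAlg F 2 α b)] [Algebra.IsCentral F (SymbolAlg F 2 α b)] {m : ℕ}
    (h : IsSymbolProduct m (brauerClass F (A ⊗[F] SymbolAlg F 2 α b))) :
    IsSymbolProduct (m + 1) (brauerClass F A) := by
  have e : brauerClass F (A ⊗[F] SymbolAlg F 2 α b) = brauerClass F A * symClass α b :=
    brauerClass_tensor
  have := h.symClass_mul α b
  rwa [e, mul_left_comm, symClass_mul_self, mul_one] at this

theorem IntermediateField.exists_eq_add_mul_of_sq_mem {K E : Type*} [Field K] [Field E]
    [Algebra K E] (hsq : ∀ c : E, c ^ 2 ∈ Set.range (algebraMap K E)) (x : E) {c : E}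
    (hc : c ∈ IntermediateField.adjoin K {x}) :
    ∃ p q : K, c = algebraMap K E p + algebraMap K E q * x := by
  induction hc using IntermediateField.adjoin_induction with
  | mem y hy =>
    obtain rfl := hy
    exact ⟨0, 1, by simp⟩
  | algebraMap y => exact ⟨y, 0, by simp⟩
  | add y z _ _ hy hz =>
    obtain ⟨p, q, rfl⟩ := hy
    obtain ⟨p', q', rfl⟩ := hz
    exact ⟨p + p', q + q', by simp only [map_add]; ring⟩
  | inv y _ hy =>
    obtain ⟨p, q, hpq⟩ := hy
    obtain ⟨d, hd⟩ := hsq y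
    by_cases h0 : y = 0
    · exact ⟨0, 0, by simp [h0]⟩
    refine ⟨d⁻¹ * p, d⁻¹ * q, ?_⟩
    rw [map_mul, map_mul, mul_assoc, ← mul_add, ← hpq, map_inv₀, hd]
    field_simp
  | mul y z _ _ hy hz =>
    obtain ⟨p, q, rfl⟩ := hy
    obtain ⟨p', q', rfl⟩ := hz
    obtain ⟨d, hd⟩ := hsq x
    refine ⟨p * p' + q * q' * d, p * q' + q * p', ?_⟩
    simp only [map_add, map_mul, hd]
    ring

theorem isSymbolProduct_of_algHom_intermediateField {E : Type} [Field E] [Algebra F E]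
    (hsq : ∀ c : E, c ^ 2 ∈ Set.range (algebraMap F E)) (M : IntermediateField F E) (hM : M.FG) :
    ∀ (A : Type) [Ring A] [Algebra F A] [FiniteDimensional F A] [IsSimpleRing A]
      [Algebra.IsCentral F A] (n : ℕ) (_ : A →ₐ[F] Matrix (Fin n) (Fin n) M),
      Module.finrank F A = n * n → ∃ m, IsSymbolProduct m (brauerClass F A) := by
  refine IntermediateField.induction_on_adjoin_fg
    (P := fun M ↦ ∀ (A : Type) [Ring A] [Algebra F A] [FiniteDimensional F A] [IsSimpleRing A]
      [Algebra.IsCentral F A] (n : ℕ) (_ : A →ₐ[F] Matrix (Fin n) (Fin n) M),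
      Module.finrank F A = n * n → ∃ m, IsSymbolProduct m (brauerClass F A))
    ?_ (fun K x ih ↦ ?_) M hM
  · intro A _ _ _ _ _ n f hf
    rw [brauerClass_eq_one_of_algHom
      ((IntermediateField.botEquiv F E).toAlgHom.mapMatrix.comp f) hf]
    exact ⟨0, isSymbolProduct_one⟩
  · by_cases hx : x ∈ K
    · have : (IntermediateField.adjoin K {x}).restrictScalars F = K := by
        rw [IntermediateField.adjoin_simple_eq_bot_iff.2, IntermediateField.restrictScalars_bot_eq_self]
        exact IntermediateField.mem_bot.2 ⟨⟨x, hx⟩, rfl⟩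
      rwa [this]
    intro A _ _ _ _ _ n f hf
    have : NeZero n := ⟨by
      rintro rfl
      exact (Module.finrank_pos (R := F) (M := A)).ne' (by simpa using hf)⟩
    let N := IntermediateField.adjoin K {x}
    let f' : A →ₐ[F] Matrix (Fin n) (Fin n) N := f
    let s : N := IntermediateField.AdjoinSimple.gen K x
    have hsx : (s : E) = x := rfl
    obtain ⟨b, hb⟩ := hsq x
    have hs : s ∉ Set.range (algebraMap K N) := by
      rintro ⟨k, hk⟩
      apply hx
      rw [← hsx, ← hk]
      exact k.2
    have hb0 : b ≠ 0 := by
      rintro rfl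
      rw [map_zero, eq_comm, sq_eq_zero_iff] at hb
      exact hx (hb ▸ K.zero_mem)
    have hsqK (c : E) : c ^ 2 ∈ Set.range (algebraMap K E) := by
      obtain ⟨d, hd⟩ := hsq c
      exact ⟨algebraMap F K d, by rw [← hd]; rfl⟩
    have hN (c : N) : ∃ p q : K, c = algebraMap K N p + algebraMap K N q * s := by
      obtain ⟨p, q, h⟩ := IntermediateField.exists_eq_add_mul_of_sq_mem hsqK x c.2
      exact ⟨p, q, Subtype.ext h⟩
    obtain ⟨α, ⟨g⟩⟩ := exists_algHom_tensor_symbolAlg_matrix (M := K) f' hf (s := s) (b := b)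
      (Subtype.ext hb.symm) hs hN fun c ↦ by
        obtain ⟨d, hd⟩ := hsq c
        exact ⟨d, Subtype.ext hd⟩
    have := SymbolAlg.isCentral α hb0
    have := SymbolAlg.isSimpleRing α hb0
    obtain ⟨m, hm⟩ := ih (A ⊗[F] SymbolAlg F 2 α b) (n * 2) g (by
        rw [Module.finrank_tensorProduct, SymbolAlg.finrank_eq, hf]
        ring)
    have : IsSimpleRing (SymbolAlg F 2 α (Units.mk0 b hb0)) := SymbolAlg.isSimpleRing α hb0
    have : Algebra.IsCentral F (SymbolAlg F 2 α (Units.mk0 b hb0)) := SymbolAlg.isCentral α hb0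
    exact ⟨m + 1, isSymbolProduct_brauerClass_of_tensor (b := Units.mk0 b hb0) hm⟩

theorem exists_isSymbolProduct_of_algHom {E : Type} [Field E] [Algebra F E]
    (hsq : ∀ c : E, c ^ 2 ∈ Set.range (algebraMap F E)) {A : Type} [Ring A] [Algebra F A]
    [FiniteDimensional F A] [IsSimpleRing A] [Algebra.IsCentral F A] {n : ℕ}
    (f : A →ₐ[F] Matrix (Fin n) (Fin n) E) (hf : Module.finrank F A = n * n) :
    ∃ m, IsSymbolProduct m (brauerClass F A) := by
  let e := Module.finBasis F A
  let S : Set E := Set.range fun t : Fin (Module.finrank F A) × Fin n × Fin n ↦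
    f (e t.1) t.2.1 t.2.2
  let M := IntermediateField.adjoin F S
  have hfM (a i j) : f a i j ∈ M := by
    rw [← e.sum_repr a, map_sum, Matrix.sum_apply]
    refine sum_mem fun k _ ↦ ?_
    rw [map_smul, Matrix.smul_apply]
    exact M.smul_mem (IntermediateField.subset_adjoin F S ⟨(k, i, j), rfl⟩)
  refine isSymbolProduct_of_algHom_intermediateField hsq M
    (IntermediateField.fg_adjoin_of_finite (Set.finite_range _)) A n
    { toFun := fun a ↦ Matrix.of fun i j ↦ ⟨f a i j, hfM a i j⟩
      map_one' := ?_, map_mul' := ?_, map_zero' := ?_, map_add' := ?_, commutes' := ?_ } hf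
  · ext i j
    simp [Matrix.one_apply, apply_ite]
  · intro a b
    ext i j
    simp [Matrix.mul_apply]
  · ext i j
    simp
  · intro a b
    ext i j
    simp
  · intro c
    ext i j
    by_cases h : i = j <;> simp [Matrix.algebraMap_matrix_apply, h]

end AlbertDescent

section PiTensorProduct

open scoped PiTensorProduct

attribute [local instance] isCentral_tensorProduct isSimpleRing_tensorProduct

variable {F : Type} [Field F]

theorem PiTensorProduct.nontrivial_of_forall {ι : Type} [Fintype ι] (Q : ι → Type)
    [∀ i, Ring (Q i)] [∀ i, Algebra F (Q i)] [∀ i, Nontrivial (Q i)] : Nontrivial (⨂[F] i, Q i) := by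
  choose φ hφ using fun i ↦ Module.Projective.exists_dual_eq_one F (one_ne_zero (α := Q i))
  let L : (⨂[F] i, Q i) →ₗ[F] F :=
    PiTensorProduct.lift ((MultilinearMap.mkPiAlgebra F ι F).compLinearMap φ)
  have hL : L (PiTensorProduct.tprod F fun _ ↦ 1) = 1 := by
    simp [L, hφ]
  refine ⟨PiTensorProduct.tprod F fun _ ↦ 1, 0, fun h ↦ zero_ne_one (α := F) ?_⟩
  rw [← hL, h, map_zero]

theorem PiTensorProduct.mem_range_of_forall_tprod {ι : Type} {Q : ι → Type}
    [∀ i, Ring (Q i)] [∀ i, Algebra F (Q i)] {B : Type} [Ring B] [Algebra F B]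
    (f : B →ₐ[F] ⨂[F] i, Q i) (h : ∀ x, PiTensorProduct.tprod F x ∈ Set.range f) :
    Function.Surjective f := by
  intro z
  induction z using PiTensorProduct.induction_on with
  | smul_tprod r x =>
    obtain ⟨y, hy⟩ := h x
    exact ⟨r • y, by rw [map_smul, hy]⟩
  | add x y hx hy =>
    obtain ⟨x, rfl⟩ := hx
    obtain ⟨y, rfl⟩ := hy
    exact ⟨x + y, map_add f x y⟩

/-- Splitting off the first factor of a tensor product of algebras. -/
noncomputable def PiTensorProduct.consAlgHom {m : ℕ} (Q : Fin (m + 1) → Type)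
    [∀ i, Ring (Q i)] [∀ i, Algebra F (Q i)] :
    Q 0 ⊗[F] (⨂[F] i : Fin m, Q i.succ) →ₐ[F] ⨂[F] i, Q i :=
  Algebra.TensorProduct.lift (PiTensorProduct.singleAlgHom 0)
    (PiTensorProduct.liftAlgHom
      { toFun := fun x ↦ PiTensorProduct.tprod F (Fin.cons 1 x : ∀ i, Q i)
        map_update_add' := fun {inst} x i y z ↦ by
          rw [Subsingleton.elim inst (instDecidableEqFin m)]
          have h (w : Q i.succ) := Fin.cons_update (α := Q) (x := 1) (p := x) (i := i) (y := w)
          rw [h, h, h]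
          exact MultilinearMap.map_update_add _ _ _ _ _
        map_update_smul' := fun {inst} x i c y ↦ by
          rw [Subsingleton.elim inst (instDecidableEqFin m)]
          have h (w : Q i.succ) := Fin.cons_update (α := Q) (x := 1) (p := x) (i := i) (y := w)
          rw [h, h]
          exact MultilinearMap.map_update_smul _ _ _ _ _ }
      (congrArg (tprod F) (funext fun i ↦ by cases i using Fin.cases <;> rfl))
      (fun x y ↦ by
        refine Eq.trans (congrArg (tprod F) (funext fun i ↦ ?_)) (tprod_mul_tprod _ _).symm
        cases i using Fin.cases <;> simp))
    (fun a z ↦ by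
      induction z using PiTensorProduct.induction_on with
      | smul_tprod r x =>
        rw [map_smul]
        refine Commute.smul_right ?_ r
        simp only [Commute, SemiconjBy, liftAlgHom_apply, lift.tprod, singleAlgHom_apply]
        refine (tprod_mul_tprod _ _).trans
          (Eq.trans (congrArg (tprod F) (funext fun i ↦ ?_)) (tprod_mul_tprod _ _).symm)
        cases i using Fin.cases <;> simp
      | add x y hx hy => rw [map_add]; exact hx.add_right hy)

theorem PiTensorProduct.consAlgHom_tmul_tprod {m : ℕ} (Q : Fin (m + 1) → Type)
    [∀ i, Ring (Q i)] [∀ i, Algebra F (Q i)] (x : ∀ i, Q i) :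
    consAlgHom (F := F) Q (x 0 ⊗ₜ tprod F fun i ↦ x i.succ) = tprod F x := by
  simp only [consAlgHom, Algebra.TensorProduct.lift_tmul, liftAlgHom_apply, lift.tprod,
    singleAlgHom_apply]
  refine (tprod_mul_tprod _ _).trans (congrArg (tprod F) (funext fun i ↦ ?_))
  cases i using Fin.cases <;> simp

theorem exists_brauerClass_piTensorProduct {m : ℕ} (Q : Fin m → Type)
    [∀ i, Ring (Q i)] [∀ i, Algebra F (Q i)] [∀ i, FiniteDimensional F (Q i)]
    [∀ i, IsSimpleRing (Q i)] [∀ i, Algebra.IsCentral F (Q i)] :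
    ∃ (_ : FiniteDimensional F (⨂[F] i, Q i)) (_ : IsSimpleRing (⨂[F] i, Q i))
      (_ : Algebra.IsCentral F (⨂[F] i, Q i)),
      brauerClass F (⨂[F] i, Q i) = ∏ i, brauerClass F (Q i) := by
  have transport {B C : Type} [Ring B] [Algebra F B] [Ring C] [Algebra F C]
      [FiniteDimensional F B] [IsSimpleRing B] [Algebra.IsCentral F B] (e : B ≃ₐ[F] C) :
      ∃ (_ : FiniteDimensional F C) (_ : IsSimpleRing C) (_ : Algebra.IsCentral F C),
        brauerClass F C = brauerClass F B := by
    have h1 : FiniteDimensional F C := e.toLinearEquiv.finiteDimensional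
    have h2 : IsSimpleRing C := IsSimpleRing.of_ringEquiv e.toRingEquiv inferInstance
    have h3 : Algebra.IsCentral F C := Algebra.IsCentral.of_algEquiv F B C e
    exact ⟨h1, h2, h3, brauerClass_eq_of_algEquiv e.symm⟩
  have hnt : Nontrivial (⨂[F] i, Q i) := PiTensorProduct.nontrivial_of_forall Q
  induction m with
  | zero =>
    have hs : Function.Surjective (Algebra.ofId F (⨂[F] i, Q i)) :=
      PiTensorProduct.mem_range_of_forall_tprod _ fun x ↦
        ⟨1, (map_one _).trans (congrArg (PiTensorProduct.tprod F) (Subsingleton.elim 1 x))⟩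
    obtain ⟨h1, h2, h3, h⟩ := transport (AlgEquiv.ofBijective (Algebra.ofId F (⨂[F] i, Q i))
      ⟨(Algebra.ofId F (⨂[F] i, Q i)).toRingHom.injective, hs⟩)
    exact ⟨h1, h2, h3, by rw [h, brauerClass_self, Finset.univ_eq_empty, Finset.prod_empty]⟩
  | succ m ih =>
    obtain ⟨_, _, _, hm⟩ := ih (fun i ↦ Q i.succ) (PiTensorProduct.nontrivial_of_forall _)
    let g := PiTensorProduct.consAlgHom (F := F) Q
    obtain ⟨h1, h2, h3, h⟩ := transport (AlgEquiv.ofBijective g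
      ⟨g.toRingHom.injective, PiTensorProduct.mem_range_of_forall_tprod _ fun x ↦
        ⟨_, PiTensorProduct.consAlgHom_tmul_tprod Q x⟩⟩)
    exact ⟨h1, h2, h3, by rw [h, brauerClass_tensor, hm, Fin.prod_univ_succ]⟩

end PiTensorProduct

section Albert

variable {F : Type} [Field F] [CharP F 2]

attribute [local instance] isCentral_tensorProduct isSimpleRing_tensorProduct

theorem exists_isSymbolProduct_of_algEquiv_end {A V : Type} [Ring A] [Algebra F A]
    [FiniteDimensional F A] [IsSimpleRing A] [Algebra.IsCentral F A] [AddCommGroup V] [Module F V]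
    [FiniteDimensional F V] (Ψ : A ⊗[F] A ≃ₐ[F] Module.End F V) :
    ∃ m, IsSymbolProduct m (brauerClass F A) := by
  obtain ⟨h, f, hf⟩ := exists_algHom_frobRoot Ψ
  exact exists_isSymbolProduct_of_algHom (F := F) (E := FrobRoot F)
    (fun c ↦ ⟨c, frobenius_def (R := F) 2 c⟩) f hf

/-- Albert's theorem for algebras of exponent dividing two in characteristic two. -/
theorem exists_isSymbolProduct_of_mul_self_eq_one {A : Type} [Ring A] [Algebra F A]
    [FiniteDimensional F A] [IsSimpleRing A] [Algebra.IsCentral F A]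
    (hA : brauerClass F A * brauerClass F A = 1) :
    ∃ m, IsSymbolProduct m (brauerClass F A) := by
  rw [← brauerClass_tensor, ← brauerClass_self, brauerClass_eq_iff] at hA
  obtain ⟨k, l, hk, hl, ⟨e⟩⟩ := hA
  have : NeZero k := ⟨hk.ne'⟩
  let Ψ : Matrix (Fin k) (Fin k) A ⊗[F] Matrix (Fin k) (Fin k) A ≃ₐ[F]
      Module.End F (Fin k × Fin l → F) :=
    (Matrix.kroneckerTMulAlgEquiv (Fin k) (Fin k) F F A A).trans <|
      (Matrix.compAlgEquiv (Fin k) (Fin k) (A ⊗[F] A) F).symm.trans <|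
      e.mapMatrix.trans <| (Matrix.compAlgEquiv (Fin k) (Fin l) F F).trans Matrix.toLinAlgEquiv'
  rw [brauerClass_eq_matrix k]
  exact exists_isSymbolProduct_of_algEquiv_end Ψ

end Albert

open scoped PiTensorProduct in
/-- Over a field `F` of characteristic 2 with `2 ≤ u(F) < ∞`, every central simple
`F`-algebra of exponent 2 is Brauer equivalent to a tensor product of at most
`u(F)/2 - 1` quaternion algebras. -/
theorem symbolLength_le_char_two (F : Type) [Field F] [CharP F 2] (u : ℕ) (hu : 2 ≤ u)
    (hu₁ : ∀ (n : ℕ) (a b : Fin n → F), AnisoBin F a b → 2 * n ≤ u)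
    (hu₂ : ∃ (n : ℕ) (a b : Fin n → F), AnisoBin F a b ∧ 2 * n = u)
    (A : Type) [Ring A] [Algebra F A] [FiniteDimensional F A]
    [IsSimpleRing A] [Algebra.IsCentral F A]
    (hexp : BrauerEquiv F (⨂[F] (_ : Fin 2), A) F) :
    ∃ (m : ℕ) (a b : Fin m → F), m ≤ u / 2 - 1 ∧ (∀ i, b i ≠ 0) ∧
      BrauerEquiv F A (⨂[F] i, SymbolAlg F 2 (a i) (b i)) := by
  obtain ⟨_, _, _, h₂⟩ := exists_brauerClass_piTensorProduct (F := F) fun _ : Fin 2 ↦ A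
  rw [Fin.prod_univ_two, brauerClass_eq_iff.2 hexp, brauerClass_self] at h₂
  obtain ⟨_, hn⟩ := exists_isSymbolProduct_of_mul_self_eq_one h₂.symm
  obtain ⟨m, hm, a, b, hab⟩ := hn.le hu₁
  have (i : Fin m) := SymbolAlg.isCentral (a i) (b i).ne_zero
  have (i : Fin m) := SymbolAlg.isSimpleRing (a i) (b i).ne_zero
  obtain ⟨_, _, _, h⟩ :=
    exists_brauerClass_piTensorProduct (F := F) fun i ↦ SymbolAlg F 2 (a i) (b i : F)
  exact ⟨m, a, fun i ↦ b i, hm, fun i ↦ (b i).ne_zero, brauerClass_eq_iff.1 (hab.trans h.symm)⟩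
end

section
/- Let F be a field of characteristic 2 with I_q³F = 0 and 4 ≤ u(F) < ∞. Then there exists an anisotropic nonsingular quadratic form over F of dimension u(F) with trivial Arf invariant. -/
/-- The norm of `r₀ + r₁i + r₂j + r₃ij` in the quaternion algebra `[d, n)` of characteristic 2, where
`i² + i = d`, `j² = n` and `ji = (i + 1)j`. -/
def quatNorm {F : Type} [Field F] (d n r₀ r₁ r₂ r₃ : F) : F :=
  r₀ ^ 2 + r₀ * r₁ + d * r₁ ^ 2 + n * (r₂ ^ 2 + r₂ * r₃ + d * r₃ ^ 2)

theorem quatNorm_mul {F : Type} [Field F] [CharP F 2] (d n a₀ a₁ a₂ a₃ r₀ r₁ r₂ r₃ : F) :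
    quatNorm d n
      (a₀ * r₀ + a₁ * (d * r₁) + a₂ * (n * (r₂ + r₃)) + a₃ * (d * n * r₃))
      (a₀ * r₁ + a₁ * (r₀ + r₁) + a₂ * (n * r₃) + a₃ * (n * r₂))
      (a₀ * r₂ + a₁ * (d * r₃) + a₂ * (r₀ + r₁) + a₃ * (d * r₁))
      (a₀ * r₃ + a₁ * (r₂ + r₃) + a₂ * r₁ + a₃ * r₀)
      = quatNorm d n a₀ a₁ a₂ a₃ * quatNorm d n r₀ r₁ r₂ r₃ := by
  unfold quatNorm
  grind

theorem quatNorm_div {F : Type} [Field F] (d n r₀ r₁ r₂ r₃ m : F) :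
    quatNorm d n (r₀ / m) (r₁ / m) (r₂ / m) (r₃ / m) = quatNorm d n r₀ r₁ r₂ r₃ / m ^ 2 := by
  unfold quatNorm
  ring

/-- If `[d, n)` with `n = x² + x + d + d'` contains an element of norm `a / a'`, then the form
`a[1, d] ⊥ a'[1, d']`, when anisotropic, represents `a * n`: right multiplication by that element
compares the subfields generated by `i` and by `i + x + j`. -/
theorem exists_eq_mul_of_quatNorm {F : Type} [Field F] [CharP F 2]
    (a a' d d' x r₀ r₁ r₂ r₃ : F)
    (hr : a' * quatNorm d (x ^ 2 + x + d + d') r₀ r₁ r₂ r₃ = a)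
    (hG : ∀ s t p q : F, a * (s ^ 2 + s * t + d * t ^ 2) + a' * (p ^ 2 + p * q + d' * q ^ 2) = 0 →
      s = 0 ∧ t = 0 ∧ p = 0 ∧ q = 0) :
    ∃ s t p q : F, a * (s ^ 2 + s * t + d * t ^ 2) + a' * (p ^ 2 + p * q + d' * q ^ 2)
      = a * (x ^ 2 + x + d + d') := by
  have h2 : (2 : F) = 0 := CharTwo.two_eq_zero
  set n := x ^ 2 + x + d + d' with hn
  have hN (p q : F) : quatNorm d n (p + q * x) q q 0 = p ^ 2 + p * q + d' * q ^ 2 := by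
    unfold quatNorm
    grind
  have hM (s t e : F) : quatNorm d n s t e 0 = s ^ 2 + s * t + d * t ^ 2 + n * e ^ 2 := by
    unfold quatNorm
    ring
  let f : (F × F × F × F) →ₗ[F] (F × F × F × F) :=
    { toFun := fun v =>
        (v.2.2.1 + v.2.2.2 * x + v.1 * r₀ + v.2.1 * (d * r₁),
         v.2.2.2 + v.1 * r₁ + v.2.1 * (r₀ + r₁),
         v.2.2.2 + v.1 * r₂ + v.2.1 * (d * r₃),
         v.1 * r₃ + v.2.1 * (r₂ + r₃))
      map_add' := fun v w => by ext <;> simp <;> ring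
      map_smul' := fun c v => by ext <;> simp <;> ring }
  have hsol (s t p q e : F) (h : f (s, t, p, q) = (e * (n * (r₂ + r₃)), e * (n * r₃),
      e * (r₀ + r₁), e * r₁)) :
      a * (s ^ 2 + s * t + d * t ^ 2) + a' * (p ^ 2 + p * q + d' * q ^ 2) = a * (n * e ^ 2) := by
    simp only [f, LinearMap.coe_mk, AddHom.coe_mk, Prod.mk.injEq] at h
    obtain ⟨h₁, h₂, h₃, h₄⟩ := h
    have key := quatNorm_mul d n s t e 0 r₀ r₁ r₂ r₃
    rw [hM] at key
    have e₁ : s * r₀ + t * (d * r₁) + e * (n * (r₂ + r₃)) + 0 * (d * n * r₃) = p + q * x := by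
      linear_combination -h₁ + (s * r₀ + t * (d * r₁)) * h2
    have e₂ : s * r₁ + t * (r₀ + r₁) + e * (n * r₃) + 0 * (n * r₂) = q := by
      linear_combination -h₂ + (s * r₁ + t * (r₀ + r₁)) * h2
    have e₃ : s * r₂ + t * (d * r₃) + e * (r₀ + r₁) + 0 * (d * r₁) = q := by
      linear_combination -h₃ + (s * r₂ + t * (d * r₃)) * h2
    have e₄ : s * r₃ + t * (r₂ + r₃) + e * r₁ + 0 * r₀ = 0 := by
      linear_combination -h₄ + (s * r₃ + t * (r₂ + r₃)) * h2
    rw [e₁, e₂, e₃, e₄, hN] at key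
    rw [key]
    linear_combination (s ^ 2 + s * t + d * t ^ 2 + n * e ^ 2) * hr
      + a * (s ^ 2 + s * t + d * t ^ 2) * h2
  have hf : Function.Injective f := by
    rw [injective_iff_map_eq_zero]
    rintro ⟨s, t, p, q⟩ h
    have := hG s t p q (by simpa using hsol s t p q 0 (by simp [h, Prod.ext_iff]))
    simp [this]
  obtain ⟨⟨s, t, p, q⟩, h⟩ := LinearMap.injective_iff_surjective.mp hf
    (n * (r₂ + r₃), n * r₃, r₀ + r₁, r₁)
  exact ⟨s, t, p, q, by simpa using hsol s t p q 1 (by simpa using h)⟩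

/-- If all quadratic 3-fold Pfister forms are isotropic, the values of an anisotropic form
`a[1, d] ⊥ a'[1, d']` absorb the nonzero values of the norm form `[1, d + d']`. -/
theorem exists_eq_mul_norm {F : Type} [Field F] [CharP F 2]
    (hI3 : ∀ a b c : F, a ≠ 0 → b ≠ 0 → ∃ v : Fin 4 → F × F, v ≠ 0 ∧
      ∑ i, (![1, a, b, a * b] i) * ((v i).1 ^ 2 + (v i).1 * (v i).2 + c * (v i).2 ^ 2) = 0)
    (a a' d d' x : F) (ha : a ≠ 0) (ha' : a' ≠ 0) (hn : x ^ 2 + x + d + d' ≠ 0)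
    (hG : ∀ s t p q : F, a * (s ^ 2 + s * t + d * t ^ 2) + a' * (p ^ 2 + p * q + d' * q ^ 2) = 0 →
      s = 0 ∧ t = 0 ∧ p = 0 ∧ q = 0) :
    ∃ s t p q : F, a * (s ^ 2 + s * t + d * t ^ 2) + a' * (p ^ 2 + p * q + d' * q ^ 2)
      = a * (x ^ 2 + x + d + d') := by
  have h2 : (2 : F) = 0 := CharTwo.two_eq_zero
  obtain ⟨n, hndef⟩ : ∃ n, n = x ^ 2 + x + d + d' := ⟨_, rfl⟩
  have hN : ∀ s t : F, s ^ 2 + s * t + d * t ^ 2 = 0 → s = 0 ∧ t = 0 := fun s t h => by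
    have := hG s t 0 0 (by rw [h]; ring)
    exact ⟨this.1, this.2.1⟩
  by_cases hsplit : ∀ p q r s : F, quatNorm d n p q r s = 0 → p = 0 ∧ q = 0 ∧ r = 0 ∧ s = 0
  · rw [← hndef] at hn
    obtain ⟨v, hv, h⟩ := hI3 n (a' / a) d hn (div_ne_zero ha' ha)
    simp only [Fin.sum_univ_four, Matrix.cons_val] at h
    set α := quatNorm d n (v 0).1 (v 0).2 (v 1).1 (v 1).2 with hα
    set β := quatNorm d n (v 2).1 (v 2).2 (v 3).1 (v 3).2 with hβ
    have hαβ : a * α = a' * β := by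
      have h' : α + a' / a * β = 0 := by
        rw [← h, hα, hβ]
        unfold quatNorm
        ring
      field_simp at h'
      linear_combination h' - a' * β * h2
    have hα0 : α ≠ 0 := by
      intro h0
      have hβ0 : β = 0 := by simpa [h0, ha'] using hαβ
      have u := hsplit _ _ _ _ (hα ▸ h0)
      have w := hsplit _ _ _ _ (hβ ▸ hβ0)
      refine hv (funext fun i => ?_)
      fin_cases i <;> ext <;> simp [u, w]
    have hr := (quatNorm_div d n _ _ _ _ α).trans <| congrArg (· / α ^ 2) <|
      quatNorm_mul d n (v 0).1 (v 0).2 (v 1).1 (v 1).2 (v 2).1 (v 2).2 (v 3).1 (v 3).2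
    rw [← hα, ← hβ, hndef] at hr
    refine exists_eq_mul_of_quatNorm a a' d d' x _ _ _ _ ((congrArg (a' * ·) hr).trans ?_) hG
    field_simp
    linear_combination -hαβ
  · push Not at hsplit
    obtain ⟨p, q, r, s, h, hne⟩ := hsplit
    unfold quatNorm at h
    by_cases hrs : r ^ 2 + r * s + d * s ^ 2 = 0
    · obtain ⟨rfl, rfl⟩ := hN _ _ hrs
      obtain ⟨rfl, rfl⟩ := hN p q (by simpa using h)
      simp at hne
    · set m := r ^ 2 + r * s + d * s ^ 2 with hm
      refine ⟨(p * r + p * s + d * q * s) / m, (p * s + q * r) / m, 0, 0, ?_⟩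
      rw [← hndef]
      have h' : p ^ 2 + p * q + d * q ^ 2 = n * m := by
        linear_combination h - n * m * h2
      have key : (p * r + p * s + d * q * s) ^ 2 + (p * r + p * s + d * q * s) * (p * s + q * r)
          + d * (p * s + q * r) ^ 2 = (p ^ 2 + p * q + d * q ^ 2) * m := by
        rw [hm]
        grind
      rw [h'] at key
      field_simp
      linear_combination a * key

theorem binSum_zero (F : Type) [Field F] {n : ℕ} (a b : Fin n → F) : binSum F a b 0 = 0 := by
  simp [binSum]

theorem binSum_smul (F : Type) [Field F] {n : ℕ} (a b : Fin n → F) (k : F) (v : Fin n → F × F) :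
    binSum F a b (k • v) = k ^ 2 * binSum F a b v := by
  simp only [binSum, Finset.mul_sum, Pi.smul_apply, Prod.smul_fst, Prod.smul_snd, smul_eq_mul]
  exact Finset.sum_congr rfl fun i _ => by ring

theorem binSum_cons (F : Type) [Field F] {n : ℕ} (a b : Fin n → F) (a₀ b₀ : F)
    (w : F × F) (v : Fin n → F × F) :
    binSum F (Fin.cons a₀ a : Fin (n + 1) → F) (Fin.cons b₀ b : Fin (n + 1) → F)
      (Fin.cons w v : Fin (n + 1) → F × F)
      = a₀ * w.1 ^ 2 + w.1 * w.2 + b₀ * w.2 ^ 2 + binSum F a b v := by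
  simp [binSum, Fin.sum_univ_succ]

/-- If all quadratic 3-fold Pfister forms are isotropic, then a nonzero form of trivial Arf invariant
is isotropic or represents every scalar. -/
theorem exists_binSum_eq_mul_sq {F : Type} [Field F] [CharP F 2]
    (hI3 : ∀ a b c : F, a ≠ 0 → b ≠ 0 → ∃ v : Fin 4 → F × F, v ≠ 0 ∧
      ∑ i, (![1, a, b, a * b] i) * ((v i).1 ^ 2 + (v i).1 * (v i).2 + c * (v i).2 ^ 2) = 0)
    (c : F) (m : ℕ) (a b : Fin (m + 1) → F) (l : F) (hl : ∑ i, a i * b i = l ^ 2 + l) :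
    ∃ (v : Fin (m + 1) → F × F) (t : F), ¬(v = 0 ∧ t = 0) ∧ binSum F a b v = c * t ^ 2 := by
  have h2 : (2 : F) = 0 := CharTwo.two_eq_zero
  induction m with
  | zero =>
    by_cases ha : a 0 = 0
    · refine ⟨fun _ => (1, 0), 0, fun h => by simpa using congrFun h.1 0, ?_⟩
      simp [binSum, ha]
    · refine ⟨fun _ => (l / a 0, 1), 0, fun h => by simpa using congrFun h.1 0, ?_⟩
      simp only [Fin.sum_univ_succ, Fin.sum_univ_zero] at hl
      simp only [binSum, Fin.sum_univ_succ, Fin.sum_univ_zero]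
      field_simp
      linear_combination hl + (l ^ 2 + l) * h2
  | succ m ih =>
    cases a using Fin.consCases with | _ a₀ a => ?_
    cases a using Fin.consCases with | _ a₁ a => ?_
    cases b using Fin.consCases with | _ b₀ b => ?_
    cases b using Fin.consCases with | _ b₁ b => ?_
    simp only [Fin.sum_univ_succ (n := m + 1), Fin.sum_univ_succ (n := m), Fin.cons_zero,
      Fin.cons_succ] at hl
    by_contra hcon
    push Not at hcon
    have hcon' (s t p q : F) (v : Fin m → F × F) (k : F)
        (h : a₀ * s ^ 2 + s * t + b₀ * t ^ 2 + (a₁ * p ^ 2 + p * q + b₁ * q ^ 2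
          + binSum F a b v) = c * k ^ 2) :
        s = 0 ∧ t = 0 ∧ p = 0 ∧ q = 0 ∧ v = 0 ∧ k = 0 := by
      by_contra hne
      refine hcon (Fin.cons (s, t) (Fin.cons (p, q) v)) k (fun hv hk => hne ?_) ?_
      · have e₀ := congrFun hv 0
        have e₁ := congrFun hv 1
        have e₂ : v = 0 := funext fun i => by simpa using congrFun hv i.succ.succ
        simp only [Fin.cons_zero, Fin.cons_one, Pi.zero_apply, Prod.mk_eq_zero] at e₀ e₁
        exact ⟨e₀.1, e₀.2, e₁.1, e₁.2, e₂, hk⟩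
      · rw [binSum_cons, binSum_cons, ← h]
    have ha₀ : a₀ ≠ 0 := fun h0 => by
      simpa using (hcon' 1 0 0 0 0 0 (by simp [h0, binSum_zero])).1
    have ha₁ : a₁ ≠ 0 := fun h0 => by
      simpa using (hcon' 0 0 1 0 0 0 (by simp [h0, binSum_zero])).2.2.1
    have hG (s t p q : F) (h : a₀ * (s ^ 2 + s * t + a₀ * b₀ * t ^ 2)
        + a₁ * (p ^ 2 + p * q + a₁ * b₁ * q ^ 2) = 0) : s = 0 ∧ t = 0 ∧ p = 0 ∧ q = 0 := by
      have := hcon' s (a₀ * t) p (a₁ * q) 0 0 (by rw [binSum_zero]; linear_combination h)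
      simp only [mul_eq_zero, ha₀, ha₁, false_or] at this
      exact ⟨this.1, this.2.1, this.2.2.1, this.2.2.2.1⟩
    have hval (x y : F) (v : Fin m → F × F) (k : F)
        (hn : a₀ * (x ^ 2 + x * y + (a₀ * b₀ + a₁ * b₁) * y ^ 2) + binSum F a b v = c * k ^ 2)
        (hn0 : x ^ 2 + x * y + (a₀ * b₀ + a₁ * b₁) * y ^ 2 ≠ 0) : False := by
      by_cases hy : y = 0
      · subst hy
        have := hcon' x 0 0 0 v k (by linear_combination hn)
        simp [this.1] at hn0
      · have hx : x ^ 2 + x * y + (a₀ * b₀ + a₁ * b₁) * y ^ 2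
            = y ^ 2 * ((x / y) ^ 2 + x / y + a₀ * b₀ + a₁ * b₁) := by
          field_simp
          ring
        rw [hx] at hn hn0
        obtain ⟨s, t, p, q, h⟩ := exists_eq_mul_norm hI3 a₀ a₁ _ _ (x / y) ha₀ ha₁
          (right_ne_zero_of_mul hn0) hG
        obtain ⟨hs, ht, hp, hq, -⟩ := hcon' (s * y) (a₀ * t * y) (p * y) (a₁ * q * y) v k
          (by linear_combination hn + y ^ 2 * h)
        have hs' : s = 0 := by simpa [hy] using hs
        have ht' : t = 0 := by simpa [hy, ha₀] using ht
        have hp' : p = 0 := by simpa [hy] using hp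
        have hq' : q = 0 := by simpa [hy, ha₁] using hq
        subst hs' ht' hp' hq'
        have h0 : a₀ * ((x / y) ^ 2 + x / y + a₀ * b₀ + a₁ * b₁) = 0 := by
          rw [← h]
          ring
        exact hn0 (by rw [(mul_eq_zero.mp h0).resolve_left ha₀, mul_zero])
    obtain ⟨w, k, hne, hw⟩ := ih (Fin.cons a₀ a) (Fin.cons ((a₀ * b₀ + a₁ * b₁) / a₀) b) (by
      rw [Fin.sum_univ_succ]
      simp only [Fin.cons_zero, Fin.cons_succ]
      rw [← hl]
      field_simp
      ring)
    cases w using Fin.consCases with | _ w v => ?_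
    obtain ⟨x, y⟩ := w
    rw [binSum_cons] at hw
    have hw' : a₀ * (x ^ 2 + x * (y / a₀) + (a₀ * b₀ + a₁ * b₁) * (y / a₀) ^ 2)
        + binSum F a b v = c * k ^ 2 := by
      rw [← hw]
      field_simp
    by_cases hn0 : x ^ 2 + x * (y / a₀) + (a₀ * b₀ + a₁ * b₁) * (y / a₀) ^ 2 = 0
    · rw [hn0, mul_zero, zero_add] at hw'
      obtain ⟨-, -, -, -, rfl, rfl⟩ := hcon' 0 0 0 0 v k (by linear_combination hw')
      obtain ⟨z, e, hze, hc⟩ : ∃ z e : F, (z ≠ 0 ∨ e ≠ 0) ∧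
          z ^ 2 + z * e + (a₀ * b₀ + a₁ * b₁) * e ^ 2 = 0 := by
        refine ⟨x, y / a₀, ?_, hn0⟩
        by_contra! hxy
        refine hne ⟨?_, rfl⟩
        have hy : y = 0 := by simpa [ha₀] using hxy.2
        rw [hxy.1, hy]
        ext i <;> refine Fin.cases ?_ (fun j => ?_) i <;> simp
      have he : e ≠ 0 := by
        rintro rfl
        simp at hze hc
        exact hze hc
      have hd : a₀ * b₀ + a₁ * b₁ = (z / e) ^ 2 + z / e := by
        field_simp
        linear_combination hc - (z ^ 2 + z * e) * h2
      have hc0 : c ≠ 0 := fun h0 => by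
        simpa using (hcon' 0 0 0 0 0 1 (by simp [h0, binSum_zero])).2.2.2.2.2
      set g := z / e
      have hyp : (c / a₀ + g + c / a₀ * g) ^ 2 + (c / a₀ + g + c / a₀ * g) * (c / a₀ + 1)
          + (g ^ 2 + g) * (c / a₀ + 1) ^ 2 = c / a₀ := by
        generalize c / a₀ = k
        grind
      refine hval (c / a₀ + g + c / a₀ * g) (c / a₀ + 1) 0 1 ?_ ?_
      · rw [hd, hyp, binSum_zero]
        field_simp
        ring
      · rw [hd, hyp]
        exact div_ne_zero hc0 ha₀
    · exact hval x (y / a₀) v k hw' hn0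

/-- If `char F = 2`, `I_q³F = 0` (encoded as: every quadratic 3-fold Pfister form
`⟨⟨a,b,c]] = [1,c] ⊥ a[1,c] ⊥ b[1,c] ⊥ ab[1,c]` is isotropic) and `4 ≤ u(F) < ∞`, then
there exists an anisotropic nonsingular quadratic form of dimension `u(F)` with trivial
Arf invariant. -/
theorem exists_aniso_trivial_arf (F : Type) [Field F] [CharP F 2] (u : ℕ) (hu : 4 ≤ u)
    (hu₁ : ∀ (n : ℕ) (a b : Fin n → F), AnisoBin F a b → 2 * n ≤ u)
    (hu₂ : ∃ (n : ℕ) (a b : Fin n → F), AnisoBin F a b ∧ 2 * n = u)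
    (hI3 : ∀ a b c : F, a ≠ 0 → b ≠ 0 → ∃ v : Fin 4 → F × F, v ≠ 0 ∧
      ∑ i, (![1, a, b, a * b] i) * ((v i).1 ^ 2 + (v i).1 * (v i).2 + c * (v i).2 ^ 2) = 0) :
    ∃ (n : ℕ) (a b : Fin n → F), 2 * n = u ∧ AnisoBin F a b ∧
      ∃ l : F, ∑ i, a i * b i = l ^ 2 + l := by
  have h2 : (2 : F) = 0 := CharTwo.two_eq_zero
  obtain ⟨n, a, b, hab, hn⟩ := hu₂
  obtain ⟨m, rfl⟩ : ∃ m, n = m + 1 + 1 := ⟨n - 2, by omega⟩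
  cases a using Fin.consCases with | _ a₀ a => ?_
  cases b using Fin.consCases with | _ b₀ b => ?_
  have haniso (s t : F) (v : Fin (m + 1) → F × F)
      (h : a₀ * s ^ 2 + s * t + b₀ * t ^ 2 + binSum F a b v = 0) : s = 0 ∧ t = 0 ∧ v = 0 := by
    have h0 := hab (Fin.cons (s, t) v) (by rw [binSum_cons, ← h])
    have e₀ := congrFun h0 0
    simp only [Fin.cons_zero, Pi.zero_apply, Prod.mk_eq_zero] at e₀
    exact ⟨e₀.1, e₀.2, funext fun i => by simpa using congrFun h0 i.succ⟩
  have ha₀ : a₀ ≠ 0 := fun h0 => by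
    simpa using (haniso 1 0 0 (by simp [h0, binSum_zero])).1
  set D := ∑ i, a i * b i with hD
  refine ⟨m + 1 + 1, Fin.cons a₀ a, Fin.cons (D / a₀) b, hn, ?_, 0, ?_⟩
  swap
  · rw [Fin.sum_univ_succ]
    simp only [Fin.cons_zero, Fin.cons_succ]
    rw [← hD]
    field_simp
    linear_combination D * h2
  intro w hw
  cases w using Fin.consCases with | _ w v => ?_
  obtain ⟨s, t⟩ := w
  rw [binSum_cons] at hw
  dsimp only at hw
  by_cases ht : t = 0
  · subst ht
    obtain ⟨rfl, -, rfl⟩ := haniso s 0 v (by linear_combination hw)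
    ext i <;> refine Fin.cases ?_ (fun j => ?_) i <;> simp
  exfalso
  obtain ⟨x, hx⟩ : ∃ x, x = t⁻¹ • v := ⟨_, rfl⟩
  have hφ : a₀ * (s / t) ^ 2 + s / t + D / a₀ + binSum F a b x = 0 := by
    rw [hx, binSum_smul]
    field_simp
    field_simp at hw
    linear_combination hw
  obtain ⟨y, k, hne, hy⟩ := exists_binSum_eq_mul_sq hI3 a₀ m
    (fun i => a i + a₀ * (x i).2 ^ 2) (fun i => b i + a₀ * (x i).1 ^ 2)
    (a₀ * (s / t) + ∑ i, a₀ * ((x i).1 * (x i).2)) (by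
      have hsum : ∑ i, (a i + a₀ * (x i).2 ^ 2) * (b i + a₀ * (x i).1 ^ 2)
          = D + a₀ * binSum F a b x + (∑ i, (a₀ * ((x i).1 * (x i).2)) ^ 2)
            - ∑ i, a₀ * ((x i).1 * (x i).2) := by
        rw [hD, binSum, Finset.mul_sum, ← Finset.sum_add_distrib, ← Finset.sum_add_distrib,
          ← Finset.sum_sub_distrib]
        exact Finset.sum_congr rfl fun i _ => by ring
      rw [hsum, ← CharTwo.sum_sq]
      have hD' : a₀ * (D / a₀) = D := mul_div_cancel₀ D ha₀
      set S := ∑ i, a₀ * ((x i).1 * (x i).2)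
      linear_combination a₀ * hφ - hD'
        - (S + a₀ ^ 2 * (s / t) ^ 2 + a₀ * (s / t) * S + a₀ * (s / t)) * h2)
  have hval : binSum F (fun i => a i + a₀ * (x i).2 ^ 2) (fun i => b i + a₀ * (x i).1 ^ 2) y
      = binSum F a b y + a₀ * (∑ i, ((x i).2 * (y i).1 + (x i).1 * (y i).2)) ^ 2 := by
    rw [CharTwo.sum_sq, binSum, binSum, Finset.mul_sum, ← Finset.sum_add_distrib]
    refine Finset.sum_congr rfl fun i _ => ?_
    linear_combination (-a₀ * ((x i).2 * (y i).1) * ((x i).1 * (y i).2)) * h2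
  rw [hval] at hy
  set ℓ := ∑ i, ((x i).2 * (y i).1 + (x i).1 * (y i).2) with hℓ
  obtain ⟨hk, -, rfl⟩ := haniso (ℓ + k) 0 y (by
    linear_combination hy + (a₀ * ℓ * k + a₀ * k ^ 2) * h2)
  refine hne ⟨rfl, ?_⟩
  simpa [hℓ] using hk
end
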